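/- arXiv:2311.03549 — 3 statements merged into one kernel-verified Lean document; each statement's English description precedes it below -/
import Mathlib

section
/- Let n ≥ 2, k ≥ 1, and let α ∈ [n]^n be complete. Then α is a k-Naples parking function (α ∈ PF_{n,k}) if and only if for every j ∈ [n] such that a_j is an RTL-maximum, there exists an integer λ_j with 0 ≤ λ_j ≤ k − u_α(a_j) such that |{i < j : a_i ∈ [a_j − u_α(a_j) − λ_j, a_j − 1]}| ≤ λ_j. -/
open Finset

/-- The spot where a single car parks on a one-way street with spots `1,…,n`:
`occ` is the set of already occupied spots, `p` is the car's preference, and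
`r` is its backward allowance (it follows the `r`-Naples rule).  If spot `p`
is free the car parks there; otherwise it checks spots `p-1, p-2, …, max (p-r) 1`
and parks in the first free one among these; otherwise it parks in the smallest
free spot `> p` (and `≤ n`); `none` means the car fails to park. -/
def parkSpot (n : ℕ) (occ : Finset ℕ) (p r : ℕ) : Option ℕ :=
  if p ∈ occ then
    if hb : ((Finset.Ico (max 1 (p - r)) p).filter (fun j => j ∉ occ)).Nonempty then
      some (((Finset.Ico (max 1 (p - r)) p).filter (fun j => j ∉ occ)).max' hb)
    else if hf : ((Finset.Ioc p n).filter (fun j => j ∉ occ)).Nonempty then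
      some (((Finset.Ioc p n).filter (fun j => j ∉ occ)).min' hf)
    else none
  else some p

/-- The set of occupied spots after the first `i` of the `m` cars (with
preferences `a` and backward allowances `r`) have attempted to park on a
street with `n` spots. -/
def occUpTo (n m : ℕ) (a r : Fin m → ℕ) : ℕ → Finset ℕ
  | 0 => ∅
  | i + 1 =>
    let occ := occUpTo n m a r i
    if h : i < m then
      match parkSpot n occ (a ⟨i, h⟩) (r ⟨i, h⟩) with
      | some s => insert s occ
      | none => occ
    else occ

/-- The outcome map: the spot where car `c_i` parks (`none` if it fails to park),
when the `m` cars with preferences `a` park on `n` spots, car `c_i` following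
the `r i`-Naples rule. -/
def outcome (n m : ℕ) (a r : Fin m → ℕ) (i : Fin m) : Option ℕ :=
  parkSpot n (occUpTo n m a r i.val) (a i) (r i)

/-- The outcome map with values in `ℕ∞`: failure to park is recorded as `∞`. -/
def outcomeE (n m : ℕ) (a r : Fin m → ℕ) (i : Fin m) : ENat :=
  (outcome n m a r i).elim ⊤ (fun s => (s : ENat))

/-- All `m` cars (preferences `a`, car `c_i` following the `r i`-Naples rule)
are able to park on the street with `n` spots.  For `m = n` this says that `r`
is a parking strategy for `a`, i.e. `(a, r) ∈ PR_n`. -/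
def AllPark (n m : ℕ) (a r : Fin m → ℕ) : Prop :=
  ∀ i : Fin m, (outcome n m a r i).isSome

instance (n m : ℕ) (a r : Fin m → ℕ) : Decidable (AllPark n m a r) := by
  unfold AllPark; infer_instance

/-- `a ∈ PF_{n,k}`: `a` is a `k`-Naples parking function of length `n`. -/
def NaplesPF (n k : ℕ) (a : Fin n → ℕ) : Prop :=
  AllPark n n a (fun _ => k)

instance (n k : ℕ) (a : Fin n → ℕ) : Decidable (NaplesPF n k a) := by
  unfold NaplesPF; infer_instance

/-- `a ∈ PF_n`: `a` is a (standard) parking function of length `n`. -/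
def IsPF (n : ℕ) (a : Fin n → ℕ) : Prop := NaplesPF n 0 a

instance (n : ℕ) (a : Fin n → ℕ) : Decidable (IsPF n a) := by
  unfold IsPF; infer_instance

/-- `u_α(j) = Σ_{i=j}^n |α|_i − (n−j+1) = #{i : a_i ≥ j} − (n−j+1)`. -/
def ucount (n : ℕ) (a : Fin n → ℕ) (j : ℕ) : ℤ :=
  ((Finset.univ.filter (fun i : Fin n => j ≤ a i)).card : ℤ) - ((n : ℤ) - (j : ℤ) + 1)

/-- `U_α = {j ∈ [n] : u_α(j) ≥ 1}`. -/
def Uset (n : ℕ) (a : Fin n → ℕ) : Finset ℕ :=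
  (Finset.Icc 1 n).filter (fun j => 1 ≤ ucount n a j)

/-- A parking preference of length `n` is complete if `U_α = {2,…,n}`. -/
def Complete (n : ℕ) (a : Fin n → ℕ) : Prop :=
  Uset n a = Finset.Icc 2 n

instance (n : ℕ) (a : Fin n → ℕ) : Decidable (Complete n a) := by
  unfold Complete; infer_instance

/-- `[p,q]` is a maximal interval of `U_α`. -/
def MaxInterval (n : ℕ) (a : Fin n → ℕ) (p q : ℕ) : Prop :=
  p ≤ q ∧ (∀ j, p ≤ j → j ≤ q → j ∈ Uset n a) ∧ p - 1 ∉ Uset n a ∧ q + 1 ∉ Uset n a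

/-- `a_j` is an RTL-maximum (right-to-left maximum) of `a`. -/
def IsRTLMax (n : ℕ) (a : Fin n → ℕ) (j : Fin n) : Prop :=
  ∀ i : Fin n, j < i → a i < a j

/-- Counting: an injective assignment cannot send `{a ≥ q}` into `[q,n]` when `α` is complete. -/
lemma count_absurd {n : ℕ} {a s : Fin n → ℕ} (hinj : Function.Injective s)
    (hu : ∀ j, 2 ≤ j → j ≤ n → n + 2 ≤ (univ.filter (fun i : Fin n => j ≤ a i)).card + j)
    (hle : ∀ i, s i ≤ n) (q : ℕ) (hq : q ≤ n)
    (h : ∀ i, q ≤ a i → q ≤ s i) : q ≤ 1 := by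
  by_contra hq1
  have h1 := hu q (by omega) hq
  have h2 : (univ.filter (fun i : Fin n => q ≤ a i)).card ≤ (Icc q n).card := by
    apply card_le_card_of_injOn s
    · intro i hi
      simp only [coe_filter, mem_univ, true_and, Set.mem_setOf_eq] at hi
      simp only [coe_Icc, Set.mem_Icc]
      exact ⟨h i hi, hle i⟩
    · exact hinj.injOn
  rw [Nat.card_Icc] at h2
  omega

/-- `s` is the outcome of the process with unlimited backward moves. -/
structure Back (n : ℕ) (a s : Fin n → ℕ) : Prop where
  pos : ∀ i, 1 ≤ s i
  le : ∀ i, s i ≤ a i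
  inj : Function.Injective s
  occ : ∀ i x, s i < x → x ≤ a i → ∃ i' < i, s i' = x

lemma Back.free {n : ℕ} {a s : Fin n → ℕ} (h : Back n a s) {i j : Fin n} (hij : i < j)
    (hs : s j ≤ a i) : s j < s i := by
  by_contra hc
  rcases lt_or_eq_of_le (not_lt.mp hc) with h1 | h1
  · obtain ⟨i', h2, h3⟩ := h.occ i _ h1 hs
    have := h.inj h3
    subst this
    exact absurd (lt_trans hij h2) (lt_irrefl _)
  · have := h.inj h1
    subst this
    exact absurd hij (lt_irrefl _)

lemma Back.last {n : ℕ} {a s : Fin n → ℕ} (h : Back n a s) (han : ∀ i, a i ≤ n)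
    (hu : ∀ j, 2 ≤ j → j ≤ n → n + 2 ≤ (univ.filter (fun i : Fin n => j ≤ a i)).card + j)
    (j : Fin n) (hj : ∀ j', j < j' → a j' < s j) : s j ≤ 1 := by
  apply count_absurd h.inj hu (fun i => (h.le i).trans (han i)) _ ((h.le j).trans (han j))
  intro i hi
  rcases lt_trichotomy i j with h1 | h1 | h1
  · exact (h.free h1 hi).le
  · rw [h1]
  · exact absurd (hj i h1) (by omega)

lemma Back.surj {n : ℕ} {a s : Fin n → ℕ} (h : Back n a s) (han : ∀ i, a i ≤ n)
    (x : ℕ) (h1 : 1 ≤ x) (hx : x ≤ n) : ∃ i, s i = x := by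
  have h2 : univ.image s = Icc 1 n := by
    apply eq_of_subset_of_card_le
    · intro y hy
      simp only [mem_image, mem_univ, true_and] at hy
      obtain ⟨i, rfl⟩ := hy
      exact mem_Icc.mpr ⟨h.pos i, (h.le i).trans (han i)⟩
    · rw [card_image_of_injective _ h.inj]; simp
  have : x ∈ univ.image s := by rw [h2]; exact mem_Icc.mpr ⟨h1, hx⟩
  simpa using this

/-- Small displacement gives the condition. -/
lemma Back.cond {n k : ℕ} {a s : Fin n → ℕ} (h : Back n a s) (han : ∀ i, a i ≤ n)
    (j : Fin n) (hj : IsRTLMax n a j) (hk : a j ≤ s j + k) :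
    ∃ lam : ℕ, (lam : ℤ) ≤ (k : ℤ) - ucount n a (a j) ∧
          ((Finset.univ.filter (fun i : Fin n => i < j ∧
              (a j : ℤ) - ucount n a (a j) - (lam : ℤ) ≤ (a i : ℤ) ∧
              (a i : ℤ) ≤ (a j : ℤ) - 1)).card : ℤ) ≤ (lam : ℤ) := by
  have hle := h.le j
  have hn := han j
  set C := univ.filter (fun i : Fin n => i < j ∧ s j ≤ a i ∧ a i < a j) with hC
  set A := univ.filter (fun i : Fin n => a j ≤ a i) with hA
  have hdisj : Disjoint C A := by
    rw [disjoint_left]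
    intro i hi hi'
    simp only [hC, hA, mem_filter, mem_univ, true_and] at hi hi'
    omega
  have hcard : (C ∪ A).card ≤ (Icc (s j) n).card := by
    apply card_le_card_of_injOn s
    · intro i hi
      simp only [hC, hA, mem_coe, mem_union, mem_filter, mem_univ, true_and] at hi
      simp only [coe_Icc, Set.mem_Icc]
      refine ⟨?_, (h.le i).trans (han i)⟩
      have hle2 : s j ≤ a i := by omega
      rcases lt_trichotomy i j with h1 | h1 | h1
      · exact (h.free h1 hle2).le
      · rw [h1]
      · have := hj i h1
        have h3 := not_lt_of_gt h1
        omega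
    · exact h.inj.injOn
  rw [card_union_of_disjoint hdisj, Nat.card_Icc] at hcard
  have hu : ucount n a (a j) = (A.card : ℤ) - ((n : ℤ) - (a j : ℤ) + 1) := rfl
  have hlam : 0 ≤ (a j : ℤ) - s j - ucount n a (a j) := by omega
  refine ⟨((a j : ℤ) - s j - ucount n a (a j)).toNat, ?_, ?_⟩
  · rw [Int.toNat_of_nonneg hlam]; omega
  · rw [Int.toNat_of_nonneg hlam]
    have hCC : univ.filter (fun i : Fin n => i < j ∧
              (a j : ℤ) - ucount n a (a j) - ((a j : ℤ) - s j - ucount n a (a j)) ≤ (a i : ℤ) ∧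
              (a i : ℤ) ≤ (a j : ℤ) - 1) = C := by
      ext i
      simp only [hC, mem_filter, mem_univ, true_and]
      constructor
      · rintro ⟨h1, h2, h3⟩
        exact ⟨h1, by omega, by omega⟩
      · rintro ⟨h1, h2, h3⟩
        exact ⟨h1, by omega, by omega⟩
    rw [hCC]
    omega

/-- The condition gives small displacement for RTL-maxima. -/
lemma Back.disp_rtl {n k : ℕ} {a s : Fin n → ℕ} (h : Back n a s) (han : ∀ i, a i ≤ n)
    (hu : ∀ j, 2 ≤ j → j ≤ n → n + 2 ≤ (univ.filter (fun i : Fin n => j ≤ a i)).card + j)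
    (j : Fin n) (lam : ℕ) (h1 : (lam : ℤ) ≤ (k : ℤ) - ucount n a (a j))
    (h2 : ((Finset.univ.filter (fun i : Fin n => i < j ∧
              (a j : ℤ) - ucount n a (a j) - (lam : ℤ) ≤ (a i : ℤ) ∧
              (a i : ℤ) ≤ (a j : ℤ) - 1)).card : ℤ) ≤ (lam : ℤ)) : a j ≤ s j + k := by
  by_contra hc
  have hle := h.le j
  have hn := han j
  have hpos := h.pos j
  have huj := hu (a j) (by omega) hn
  set A := univ.filter (fun i : Fin n => a j ≤ a i) with hA
  have hud : ucount n a (a j) = (A.card : ℤ) - ((n : ℤ) - (a j : ℤ) + 1) := rfl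
  obtain ⟨w, hw⟩ : ∃ w : ℕ, (w : ℤ) = (a j : ℤ) - ucount n a (a j) - (lam : ℤ) :=
    ⟨((a j : ℤ) - ucount n a (a j) - (lam : ℤ)).toNat, Int.toNat_of_nonneg (by omega)⟩
  rw [← hw] at h2
  set C := univ.filter (fun i : Fin n => i < j ∧ (w : ℤ) ≤ (a i : ℤ) ∧
              (a i : ℤ) ≤ (a j : ℤ) - 1) with hC
  have hjA : j ∈ A := by simp [hA]
  have hsub : Icc w n ⊆ (C ∪ A.erase j).image s := by
    intro x hx
    rw [mem_Icc] at hx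
    obtain ⟨i, rfl⟩ := h.surj han x (by omega) hx.2
    apply mem_image_of_mem
    have hij : i ≠ j := by
      rintro rfl
      omega
    have hai := h.le i
    rw [mem_union, mem_erase]
    by_cases hv : a j ≤ a i
    · right
      exact ⟨hij, by simp [hA, hv]⟩
    · left
      simp only [hC, mem_filter, mem_univ, true_and]
      refine ⟨?_, by omega, by omega⟩
      obtain ⟨i', h3, h4⟩ := h.occ j (s i) (by omega) (by omega)
      rw [← h.inj h4]
      exact h3
  have h3 := (card_le_card hsub).trans (card_image_le.trans (card_union_le _ _))
  rw [Nat.card_Icc, card_erase_of_mem hjA] at h3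
  omega

/-- Displacement bound at RTL-maxima gives it everywhere. -/
lemma Back.disp_all {n k : ℕ} {a s : Fin n → ℕ} (h : Back n a s) (han : ∀ i, a i ≤ n)
    (hu : ∀ j, 2 ≤ j → j ≤ n → n + 2 ≤ (univ.filter (fun i : Fin n => j ≤ a i)).card + j)
    (hR : ∀ j, IsRTLMax n a j → a j ≤ s j + k) (i : Fin n) : a i ≤ s i + k := by
  have hne : (univ.filter (fun j : Fin n => a i ≤ a j)).Nonempty := ⟨i, by simp⟩
  obtain ⟨j, hj, hmax⟩ := exists_max_image _ (fun j : Fin n => j) hne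
  simp only [mem_filter, mem_univ, true_and] at hj hmax
  have hlast : ∀ j', j < j' → a j' < a i := by
    intro j' hj'
    by_contra hc
    exact absurd (hmax j' (not_lt.mp hc)) (not_le.mpr hj')
  have hRj := hR j (fun j' hj' => lt_of_lt_of_le (hlast j' hj') hj)
  rcases lt_or_eq_of_le (hmax i le_rfl) with hij | hij
  · by_cases hc : a i ≤ s j
    · have := h.last han hu j (fun j' hj' => lt_of_lt_of_le (hlast j' hj') hc)
      have := h.pos i
      omega
    · have := h.free hij (by omega)
      omega
  · rw [hij]; exact hRj

/-- Existence of the unlimited backward outcome, for the first `m` cars. -/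
lemma back_exists_aux {n : ℕ} {a : Fin n → ℕ} (ha1 : ∀ i, 1 ≤ a i)
    (hu : ∀ j, 2 ≤ j → j ≤ n → n + 2 ≤ (univ.filter (fun i : Fin n => j ≤ a i)).card + j)
    (m : ℕ) (hm : m ≤ n) : ∃ s : Fin n → ℕ, ∀ i : Fin n, i.val < m →
      1 ≤ s i ∧ s i ≤ a i ∧ (∀ i' < i, s i' ≠ s i) ∧
      ∀ x, s i < x → x ≤ a i → ∃ i' < i, s i' = x := by
  induction m with
  | zero => exact ⟨fun _ => 0, fun i hi => absurd hi (by omega)⟩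
  | succ m ih =>
    obtain ⟨s, hs⟩ := ih (by omega)
    set c : Fin n := ⟨m, by omega⟩ with hc
    set O := (univ.filter (fun i : Fin n => i < c)).image s with hO
    have hmem : ∀ x, x ∈ O ↔ ∃ i < c, s i = x := by
      intro x; simp [hO]
    have hlt : ∀ i : Fin n, i < c → i.val < m := fun i hi => hi
    have hfree : ∃ x, 1 ≤ x ∧ x ≤ a c ∧ x ∉ O := by
      by_contra hno
      push Not at hno
      have hex : ∃ q, 1 ≤ q ∧ q ∉ O := by
        obtain ⟨q, hq⟩ := Infinite.exists_notMem_finset (insert 0 O)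
        rw [mem_insert, not_or] at hq
        exact ⟨q, by omega, hq.2⟩
      classical
      obtain ⟨hq1, hqO⟩ := Nat.find_spec hex
      have hqmin : ∀ x, 1 ≤ x → x < Nat.find hex → x ∈ O := by
        intro x hx hxq
        have := Nat.find_min hex hxq
        by_contra hxO
        exact this ⟨hx, hxO⟩
      set q := Nat.find hex with hqdef
      have hqa : a c < q := by
        by_contra hcq
        exact hqO (hno q hq1 (not_lt.mp hcq))
      have hac := ha1 c
      set L := univ.filter (fun i : Fin n => a i < q) with hL
      have hcL : c ∈ L := by simp [hL, hqa]
      have hsub : Ico 1 q ⊆ (L.erase c).image s := by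
        intro x hx
        rw [mem_Ico] at hx
        obtain ⟨i, hi, rfl⟩ := (hmem x).mp (hqmin x hx.1 hx.2)
        apply mem_image_of_mem
        rw [mem_erase]
        refine ⟨hi.ne, ?_⟩
        simp only [hL, mem_filter, mem_univ, true_and]
        by_contra hai
        obtain ⟨i', h3, h4⟩ := (hs i (hlt i hi)).2.2.2 q hx.2 (not_lt.mp hai)
        exact hqO ((hmem q).mpr ⟨i', h3.trans hi, h4⟩)
      have h3 := (card_le_card hsub).trans card_image_le
      rw [Nat.card_Ico, card_erase_of_mem hcL] at h3
      have hLpos : 0 < L.card := card_pos.mpr ⟨c, hcL⟩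
      have h4 := card_filter_add_card_filter_not (s := (univ : Finset (Fin n)))
        (fun i : Fin n => a i < q)
      simp only [not_lt, card_univ, Fintype.card_fin] at h4
      rw [← hL] at h4
      by_cases hqn : q ≤ n
      · have := hu q (by omega) hqn
        omega
      · omega
    have hne : ((Icc 1 (a c)).filter (fun x => x ∉ O)).Nonempty := by
      obtain ⟨x, h1, h2, h3⟩ := hfree
      exact ⟨x, by simp [h1, h2, h3]⟩
    obtain ⟨t, ht, htmax⟩ := exists_max_image _ (fun x : ℕ => x) hne
    simp only [mem_filter, mem_Icc] at ht htmax
    refine ⟨Function.update s c t, ?_⟩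
    intro i hi
    have hic : i ≤ c := Nat.lt_succ_iff.mp hi
    have hup : ∀ i' : Fin n, i' < c → Function.update s c t i' = s i' :=
      fun i' h => Function.update_of_ne h.ne _ _
    rcases lt_or_eq_of_le hic with h1 | h1
    · obtain ⟨g1, g2, g3, g4⟩ := hs i (hlt i h1)
      rw [hup i h1]
      refine ⟨g1, g2, ?_, ?_⟩
      · intro i' hi'
        rw [hup i' (hi'.trans h1)]
        exact g3 i' hi'
      · intro x hx hx'
        obtain ⟨i', h5, h6⟩ := g4 x hx hx'
        exact ⟨i', h5, by rw [hup i' (h5.trans h1)]; exact h6⟩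
    · rw [h1, Function.update_self]
      refine ⟨ht.1.1, ht.1.2, ?_, ?_⟩
      · intro i' hi' he
        rw [hup i' hi'] at he
        exact ht.2 ((hmem t).mpr ⟨i', hi', he⟩)
      · intro x hx hx'
        have hxO : x ∈ O := by
          by_contra hxO
          have := htmax x ⟨⟨by omega, hx'⟩, hxO⟩
          omega
        obtain ⟨i', h5, h6⟩ := (hmem x).mp hxO
        exact ⟨i', h5, by rw [hup i' h5]; exact h6⟩

lemma inj_of_lt {n : ℕ} {s : Fin n → ℕ} (h : ∀ i, ∀ i' < i, s i' ≠ s i) :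
    Function.Injective s := by
  intro i j hij
  rcases lt_trichotomy i j with h1 | h1 | h1
  · exact absurd hij (h j i h1)
  · exact h1
  · exact absurd hij.symm (h i j h1)

lemma back_exists {n : ℕ} {a : Fin n → ℕ} (ha1 : ∀ i, 1 ≤ a i)
    (hu : ∀ j, 2 ≤ j → j ≤ n → n + 2 ≤ (univ.filter (fun i : Fin n => j ≤ a i)).card + j) :
    ∃ s, Back n a s := by
  obtain ⟨s, hs⟩ := back_exists_aux ha1 hu n le_rfl
  exact ⟨s, fun i => (hs i i.2).1, fun i => (hs i i.2).2.1,
    inj_of_lt fun i => (hs i i.2).2.2.1, fun i => (hs i i.2).2.2.2⟩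

/-- If the outcomes of the first `m` cars are `s`, the occupied set is the image. -/
lemma occ_eq {n : ℕ} {a r s : Fin n → ℕ} (m : ℕ) (hm : m ≤ n)
    (h : ∀ i : Fin n, i.val < m → outcome n n a r i = some (s i)) (x : ℕ) :
    x ∈ occUpTo n n a r m ↔ ∃ i : Fin n, i.val < m ∧ s i = x := by
  induction m with
  | zero => simp [occUpTo]
  | succ m ih =>
    have ih := ih (by omega) (fun i hi => h i (by omega))
    have hc := h ⟨m, by omega⟩ (by simp)
    unfold outcome at hc
    simp only at hc
    have hmn : m < n := by omega
    simp only [occUpTo, hmn, dif_pos, hc, mem_insert, ih]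
    constructor
    · rintro (rfl | ⟨i, hi, rfl⟩)
      · exact ⟨⟨m, hmn⟩, by simp, rfl⟩
      · exact ⟨i, by omega, rfl⟩
    · rintro ⟨i, hi, rfl⟩
      rcases lt_or_eq_of_le (Nat.lt_succ_iff.mp hi) with h1 | h1
      · exact Or.inr ⟨i, h1, rfl⟩
      · left; congr 1; exact Fin.ext h1

lemma parkSpot_back {n p r t : ℕ} {O : Finset ℕ} (h1 : 1 ≤ t) (h2 : t ≤ p) (h3 : p ≤ t + r)
    (h4 : t ∉ O) (h5 : ∀ x, t < x → x ≤ p → x ∈ O) : parkSpot n O p r = some t := by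
  unfold parkSpot
  rcases lt_or_eq_of_le h2 with h | h
  · rw [if_pos (h5 p h le_rfl)]
    have ht : t ∈ (Finset.Ico (max 1 (p - r)) p).filter (fun j => j ∉ O) := by
      simp only [mem_filter, mem_Ico]
      exact ⟨⟨by omega, h⟩, h4⟩
    rw [dif_pos ⟨t, ht⟩]
    congr 1
    apply le_antisymm
    · apply max'_le
      intro y hy
      simp only [mem_filter, mem_Ico] at hy
      by_contra hc
      exact hy.2 (h5 y (by omega) (by omega))
    · exact le_max' _ _ ht
  · subst h
    rw [if_neg h4]

lemma parkSpot_spec {n p r t : ℕ} {O : Finset ℕ} (hp : 1 ≤ p) (hpn : p ≤ n)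
    (h : parkSpot n O p r = some t) :
    1 ≤ t ∧ t ≤ n ∧ t ∉ O ∧ ((t ≤ p ∧ p ≤ t + r ∧ ∀ x, t < x → x ≤ p → x ∈ O) ∨
      (p < t ∧ ∀ x, 1 ≤ x → p ≤ x + r → x < t → x ∈ O)) := by
  unfold parkSpot at h
  split_ifs at h with h1 h2 h3
  · have ht := max'_mem _ h2
    have hmx := fun y hy => le_max' ((Finset.Ico (max 1 (p - r)) p).filter (fun j => j ∉ O)) y hy
    rw [Option.some.inj h] at ht
    simp only [Option.some.inj h] at hmx
    simp only [mem_filter, mem_Ico] at ht hmx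
    refine ⟨by omega, by omega, ht.2, Or.inl ⟨by omega, by omega, ?_⟩⟩
    intro x hx hxp
    by_contra hxO
    rcases lt_or_eq_of_le hxp with h4 | h4
    · have := hmx x ⟨⟨by omega, h4⟩, hxO⟩
      omega
    · subst h4; exact hxO h1
  · have ht := min'_mem _ h3
    have hmn := fun y hy => min'_le ((Finset.Ioc p n).filter (fun j => j ∉ O)) y hy
    rw [Option.some.inj h] at ht
    simp only [Option.some.inj h] at hmn
    simp only [mem_filter, mem_Ioc] at ht hmn
    refine ⟨by omega, by omega, ht.2, Or.inr ⟨by omega, ?_⟩⟩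
    intro x hx1 hx2 hx3
    by_contra hxO
    rcases lt_trichotomy x p with h4 | h4 | h4
    · apply h2
      refine ⟨x, ?_⟩
      simp only [mem_filter, mem_Ico]
      exact ⟨⟨by omega, h4⟩, hxO⟩
    · subst h4; exact hxO h1
    · have := hmn x ⟨⟨h4, by omega⟩, hxO⟩
      omega
  · have := Option.some.inj h
    subst this
    exact ⟨hp, hpn, h1, Or.inl ⟨le_rfl, by omega, fun x hx hx' => absurd hx (by omega)⟩⟩

lemma Back.allPark {n k : ℕ} {a s : Fin n → ℕ} (h : Back n a s)
    (hk : ∀ i, a i ≤ s i + k) : NaplesPF n k a := by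
  have key : ∀ m : ℕ, m ≤ n → ∀ i : Fin n, i.val < m →
      outcome n n a (fun _ => k) i = some (s i) := by
    intro m
    induction m with
    | zero => intro _ i hi; exact absurd hi (by omega)
    | succ m ih =>
      intro hm i hi
      rcases lt_or_eq_of_le (Nat.lt_succ_iff.mp hi) with h1 | h1
      · exact ih (by omega) i h1
      · have hocc := occ_eq m (by omega) (ih (by omega))
        unfold outcome
        rw [h1]
        apply parkSpot_back (h.pos i) (h.le i) (hk i)
        · rw [hocc]
          rintro ⟨i', h2, h3⟩
          have := h.inj h3
          subst this
          omega
        · intro x hx hx'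
          rw [hocc]
          obtain ⟨i', h2, h3⟩ := h.occ i x hx hx'
          exact ⟨i', by rw [← h1]; exact h2, h3⟩
  intro i
  rw [key n le_rfl i i.2]
  rfl

lemma back_of_naples {n k : ℕ} {a : Fin n → ℕ} (ha1 : ∀ i, 1 ≤ a i) (han : ∀ i, a i ≤ n)
    (hu : ∀ j, 2 ≤ j → j ≤ n → n + 2 ≤ (univ.filter (fun i : Fin n => j ≤ a i)).card + j)
    (h : NaplesPF n k a) : ∃ s, Back n a s ∧ ∀ i, a i ≤ s i + k := by
  have hex : ∀ i, ∃ t, outcome n n a (fun _ => k) i = some t :=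
    fun i => Option.isSome_iff_exists.mp (h i)
  choose s hs using hex
  have hocc : ∀ (i : Fin n) x, x ∈ occUpTo n n a (fun _ => k) i.val ↔ ∃ i' < i, s i' = x :=
    fun i x => occ_eq i.val i.2.le (fun i' _ => hs i') x
  have spec := fun i => parkSpot_spec (ha1 i) (han i) (hs i)
  simp only [hocc] at spec
  have hinj : Function.Injective s :=
    inj_of_lt fun i i' hi he => (spec i).2.2.1 ⟨i', hi, he⟩
  have hback : ∀ c, s c ≤ a c := by
    intro c
    by_contra hc
    obtain ⟨-, hsn, -, hor⟩ := spec c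
    obtain ⟨hlt, hf⟩ := hor.resolve_left (fun hh => hc hh.1)
    have := count_absurd hinj hu (fun i => (spec i).2.1) (s c) hsn (by
      intro i hi
      by_contra hsi
      obtain ⟨g1, -, -, g4⟩ := spec i
      rcases g4 with ⟨g5, g6, g7⟩ | ⟨g5, -⟩
      · obtain ⟨c', h2, h3⟩ := g7 (s c) (by omega) hi
        have := hinj h3
        subst this
        obtain ⟨i', h4, h5⟩ := hf (s i) g1 (by omega) (by omega)
        have := hinj h5
        subst this
        exact absurd (h2.trans h4) (lt_irrefl _)
      · omega)
    have := ha1 c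
    omega
  have hb : ∀ i, a i ≤ s i + k ∧ ∀ x, s i < x → x ≤ a i → ∃ i' < i, s i' = x := by
    intro i
    have := hback i
    rcases (spec i).2.2.2 with ⟨_, g⟩ | ⟨g, -⟩
    · exact g
    · omega
  exact ⟨s, ⟨fun i => (spec i).1, hback, hinj, fun i => (hb i).2⟩, fun i => (hb i).1⟩

lemma complete_count {n : ℕ} {a : Fin n → ℕ} (hcomp : Complete n a) :
    ∀ j, 2 ≤ j → j ≤ n → n + 2 ≤ (univ.filter (fun i : Fin n => j ≤ a i)).card + j := by
  intro j h2 hj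
  have hmem : j ∈ Uset n a := by
    rw [show Uset n a = Icc 2 n from hcomp]
    exact mem_Icc.mpr ⟨h2, hj⟩
  have := (mem_filter.mp hmem).2
  unfold ucount at this
  omega

/-- a complete `α ∈ [n]^n` is in `PF_{n,k}` iff for every index `j`
with `a_j` an RTL-maximum there is `0 ≤ λ_j ≤ k − u_α(a_j)` with
`|{i < j : a_i ∈ [a_j − u_α(a_j) − λ_j, a_j − 1]}| ≤ λ_j`. -/
theorem statement10 (n k : ℕ) (hn : 2 ≤ n) (hk : 1 ≤ k) (a : Fin n → ℕ)
    (ha : ∀ i, a i ∈ Finset.Icc 1 n) (hcomp : Complete n a) :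
    NaplesPF n k a ↔
      ∀ j : Fin n, IsRTLMax n a j →
        ∃ lam : ℕ, (lam : ℤ) ≤ (k : ℤ) - ucount n a (a j) ∧
          ((Finset.univ.filter (fun i : Fin n => i < j ∧
              (a j : ℤ) - ucount n a (a j) - (lam : ℤ) ≤ (a i : ℤ) ∧
              (a i : ℤ) ≤ (a j : ℤ) - 1)).card : ℤ) ≤ (lam : ℤ) := by
  have ha1 : ∀ i, 1 ≤ a i := fun i => (mem_Icc.mp (ha i)).1
  have han : ∀ i, a i ≤ n := fun i => (mem_Icc.mp (ha i)).2
  have hu := complete_count hcomp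
  constructor
  · intro h j hj
    obtain ⟨s, hs, hk'⟩ := back_of_naples ha1 han hu h
    exact hs.cond han j hj (hk' j)
  · intro h
    obtain ⟨s, hs⟩ := back_exists ha1 hu
    apply hs.allPark
    apply hs.disp_all han hu
    intro j hj
    obtain ⟨lam, h1, h2⟩ := h j hj
    exact hs.disp_rtl han hu j lam h1 h2
end

section
/- Let n ≥ 1, k ≥ 1, and α ∈ [n]^n. Then α is a k-Naples parking function (α ∈ PF_{n,k}) if and only if for every maximal interval [p,q] of U_α there exists a set J ⊆ [n] with |J| ≥ q−p+2 such that a_j ∈ [p−1, p−2+|J|] for all j ∈ J, and the translated subsequence τ_{p−2}(α|_J) is a complete k-Naples parking function of length |J|. -/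
open Finset

/-- The translated restriction `τ_w(α|_J)`: the subsequence of `a` indexed by
`J` (in increasing order of indices), with `w` subtracted from every entry. -/
def restrictTranslate (n : ℕ) (a : Fin n → ℕ) (J : Finset (Fin n)) (w : ℕ) :
    Fin J.card → ℕ :=
  fun t => a ((J.orderIsoOfFin rfl) t).val - w

/-! ### Specification of the parking rule -/

theorem parkSpot_eq_some (n : ℕ) (occ : Finset ℕ) (p r s : ℕ) (hp : 1 ≤ p) :
    parkSpot n occ p r = some s ↔
      s ∉ occ ∧ (s = p ∨
        (p ∈ occ ∧ s < p ∧ 1 ≤ s ∧ p ≤ s + r ∧ ∀ x, s < x → x ≤ p → x ∈ occ) ∨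
        (p ∈ occ ∧ p < s ∧ s ≤ n ∧ ∀ x, 1 ≤ x → p ≤ x + r → x < s → x ∈ occ)) := by
  unfold parkSpot
  split_ifs with h1 hb hf
  · rw [Option.some.injEq, Finset.max'_eq_iff]
    obtain ⟨y, hy⟩ := hb
    simp only [Finset.mem_filter, Finset.mem_Ico] at hy ⊢
    constructor
    · rintro ⟨⟨⟨h2, h3⟩, h4⟩, h5⟩
      refine ⟨h4, Or.inr (Or.inl ⟨h1, h3, by omega, by omega, ?_⟩)⟩
      intro x hx hxp
      by_contra hxo
      rcases Nat.lt_or_ge x p with h | h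
      · have := h5 x ⟨⟨by omega, h⟩, hxo⟩
        omega
      · have : x = p := by omega
        subst this; exact hxo h1
    · rintro ⟨h4, h | ⟨_, h3, h5, h6, h7⟩ | ⟨_, h3, h5, h6⟩⟩
      · subst h; exact absurd h1 h4
      · refine ⟨⟨⟨by omega, h3⟩, h4⟩, ?_⟩
        intro x hx
        by_contra hlt
        exact hx.2 (h7 x (by omega) (by omega))
      · exact absurd (h6 y (by omega) (by omega) (by omega)) hy.2
  · rw [Option.some.injEq, Finset.min'_eq_iff]
    simp only [Finset.not_nonempty_iff_eq_empty, Finset.filter_eq_empty_iff, Finset.mem_Ico,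
      not_not] at hb
    simp only [Finset.mem_filter, Finset.mem_Ioc]
    constructor
    · rintro ⟨⟨⟨h2, h3⟩, h4⟩, h5⟩
      refine ⟨h4, Or.inr (Or.inr ⟨h1, h2, h3, ?_⟩)⟩
      intro x hx1 hx2 hx3
      by_contra hxo
      rcases Nat.lt_trichotomy x p with h | h | h
      · exact hxo (hb ⟨by omega, h⟩)
      · subst h; exact hxo h1
      · have := h5 x ⟨⟨h, by omega⟩, hxo⟩
        omega
    · rintro ⟨h4, h | ⟨_, h3, h5, h6, h7⟩ | ⟨_, h3, h5, h6⟩⟩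
      · subst h; exact absurd h1 h4
      · exact absurd (hb ⟨by omega, h3⟩) h4
      · refine ⟨⟨⟨h3, h5⟩, h4⟩, ?_⟩
        intro x hx
        by_contra hlt
        exact hx.2 (h6 x (by omega) (by omega) (by omega))
  · simp only [Finset.not_nonempty_iff_eq_empty, Finset.filter_eq_empty_iff, Finset.mem_Ico,
      not_not, Finset.mem_Ioc] at hb hf
    simp only [false_iff]
    rintro ⟨h4, h | ⟨_, h3, h5, h6, h7⟩ | ⟨_, h3, h5, h6⟩⟩
    · subst h; exact absurd h1 h4
    · exact absurd (hb ⟨by omega, h3⟩) h4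
    · exact absurd (hf ⟨h3, h5⟩) h4
  · rw [Option.some.injEq]
    constructor
    · rintro rfl; exact ⟨h1, Or.inl rfl⟩
    · rintro ⟨h4, h | ⟨h, _⟩ | ⟨h, _⟩⟩
      · exact h.symm
      · exact absurd h h1
      · exact absurd h h1

theorem parkSpot_eq_none (n : ℕ) (occ : Finset ℕ) (p r : ℕ)
    (h : parkSpot n occ p r = none) :
    p ∈ occ ∧ ∀ x, p ≤ x → x ≤ n → x ∈ occ := by
  unfold parkSpot at h
  split_ifs at h with h1 hb hf
  refine ⟨h1, fun x hx hn => ?_⟩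
  simp only [Finset.not_nonempty_iff_eq_empty, Finset.filter_eq_empty_iff,
      not_not, Finset.mem_Ioc] at hf
  rcases Nat.eq_or_lt_of_le hx with h | h
  · subst h; exact h1
  · exact hf ⟨h, hn⟩

theorem mem_occUpTo (n m : ℕ) (a r : Fin m → ℕ) (i : ℕ) (s : ℕ) :
    s ∈ occUpTo n m a r i ↔ ∃ j : Fin m, j.val < i ∧ outcome n m a r j = some s := by
  induction i with
  | zero => simp [occUpTo]
  | succ i ih =>
    simp only [occUpTo]
    split_ifs with h
    · have key : (∃ j : Fin m, j.val < i + 1 ∧ outcome n m a r j = some s) ↔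
          (outcome n m a r ⟨i, h⟩ = some s ∨ ∃ j : Fin m, j.val < i ∧ outcome n m a r j = some s) := by
        constructor
        · rintro ⟨j, hj, hs⟩
          rcases Nat.lt_succ_iff_lt_or_eq.mp hj with h' | h'
          · exact Or.inr ⟨j, h', hs⟩
          · left; rw [← hs]; congr 1; exact Fin.ext h'.symm
        · rintro (h' | ⟨j, hj, hs⟩)
          · exact ⟨⟨i, h⟩, Nat.lt_succ_self i, h'⟩
          · exact ⟨j, Nat.lt_succ_of_lt hj, hs⟩
      rw [key, ← ih]
      have ho : outcome n m a r ⟨i, h⟩ =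
        parkSpot n (occUpTo n m a r i) (a ⟨i, h⟩) (r ⟨i, h⟩) := rfl
      rw [ho]
      cases hps : parkSpot n (occUpTo n m a r i) (a ⟨i, h⟩) (r ⟨i, h⟩) with
      | none => simp
      | some y => simp [eq_comm]
    · rw [ih]
      constructor
      · rintro ⟨j, hj, hs⟩; exact ⟨j, by omega, hs⟩
      · rintro ⟨j, hj, hs⟩; exact ⟨j, by have := j.isLt; omega, hs⟩

/-- Specification of the outcome map in terms of earlier outcomes. -/
theorem outcome_eq_some (n m k : ℕ) (a : Fin m → ℕ) (i : Fin m) (s : ℕ) (hp : 1 ≤ a i) :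
    outcome n m a (fun _ => k) i = some s ↔
      (∀ j < i, outcome n m a (fun _ => k) j ≠ some s) ∧ (s = a i ∨
        (s < a i ∧ 1 ≤ s ∧ a i ≤ s + k ∧
          ∀ x, s < x → x ≤ a i → ∃ j < i, outcome n m a (fun _ => k) j = some x) ∨
        (a i < s ∧ s ≤ n ∧
          ∀ x, 1 ≤ x → a i ≤ x + k → x < s → ∃ j < i, outcome n m a (fun _ => k) j = some x)) := by
  have h0 := parkSpot_eq_some n (occUpTo n m a (fun _ => k) i.val) (a i) k s hp
  have h1 : outcome n m a (fun _ => k) i =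
    parkSpot n (occUpTo n m a (fun _ => k) i.val) (a i) k := rfl
  rw [h1, h0]
  simp only [mem_occUpTo]
  constructor
  · rintro ⟨h2, h3⟩
    refine ⟨fun j hj hs => h2 ⟨j, hj, hs⟩, ?_⟩
    rcases h3 with h | ⟨_, h⟩ | ⟨_, h⟩
    · exact Or.inl h
    · exact Or.inr (Or.inl h)
    · exact Or.inr (Or.inr h)
  · rintro ⟨h2, h3⟩
    refine ⟨fun ⟨j, hj, hs⟩ => h2 j hj hs, ?_⟩
    rcases h3 with h | h | h
    · exact Or.inl h
    · exact Or.inr (Or.inl ⟨h.2.2.2 _ h.1 le_rfl, h⟩)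
    · exact Or.inr (Or.inr ⟨h.2.2 _ hp (by omega) h.1, h⟩)

theorem outcome_eq_none (n m k : ℕ) (a : Fin m → ℕ) (i : Fin m)
    (h : outcome n m a (fun _ => k) i = none) :
    ∀ x, a i ≤ x → x ≤ n → ∃ j < i, outcome n m a (fun _ => k) j = some x := by
  intro x hx hn
  have := (parkSpot_eq_none n (occUpTo n m a (fun _ => k) i.val) (a i) k h).2 x hx hn
  rw [mem_occUpTo] at this
  exact this

/-- `f` records a successful parking process of `n` cars on `n` spots. -/
structure Parks (n k : ℕ) (a f : Fin n → ℕ) : Prop where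
  inj : Function.Injective f
  rng : ∀ i, 1 ≤ f i ∧ f i ≤ n
  surj : ∀ x, 1 ≤ x → x ≤ n → ∃ i, f i = x
  spec : ∀ i, f i = a i ∨
    (f i < a i ∧ a i ≤ f i + k ∧ ∀ x, f i < x → x ≤ a i → ∃ j < i, f j = x) ∨
    (a i < f i ∧ ∀ x, 1 ≤ x → a i ≤ x + k → x < f i → ∃ j < i, f j = x)

theorem surj_of_inj {n : ℕ} {f : Fin n → ℕ} (inj : Function.Injective f)
    (rng : ∀ i, 1 ≤ f i ∧ f i ≤ n) : ∀ x, 1 ≤ x → x ≤ n → ∃ i, f i = x := by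
  intro x h1 h2
  have himg : Finset.univ.image f = Finset.Icc 1 n := by
    apply Finset.eq_of_subset_of_card_le
    · intro y hy
      simp only [Finset.mem_image, Finset.mem_univ, true_and] at hy
      obtain ⟨i, rfl⟩ := hy
      exact Finset.mem_Icc.mpr (rng i)
    · rw [Finset.card_image_of_injective _ inj]; simp
  have : x ∈ Finset.univ.image f := by rw [himg]; exact Finset.mem_Icc.mpr ⟨h1, h2⟩
  simpa using this

theorem naples_parks {n k : ℕ} {a : Fin n → ℕ} (ha : ∀ i, 1 ≤ a i ∧ a i ≤ n)
    (h : NaplesPF n k a) : ∃ f, Parks n k a f ∧ ∀ i, outcome n n a (fun _ => k) i = some (f i) := by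
  have h' : ∀ i, ∃ s, outcome n n a (fun _ => k) i = some s :=
    fun i => Option.isSome_iff_exists.mp (h i)
  choose f hf using h'
  have hs := fun i => (outcome_eq_some n n k a i (f i) (ha i).1).mp (hf i)
  simp only [hf, Option.some.injEq, ne_eq] at hs
  have inj : Function.Injective f := by
    intro i j hij
    rcases lt_trichotomy i j with h | h | h
    · exact absurd hij ((hs j).1 i h)
    · exact h
    · exact absurd hij.symm ((hs i).1 j h)
  have rng : ∀ i, 1 ≤ f i ∧ f i ≤ n := by
    intro i
    have := ha i
    rcases (hs i).2 with h | h | h <;> omega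
  refine ⟨f, ⟨inj, rng, surj_of_inj inj rng, ?_⟩, hf⟩
  intro i
  rcases (hs i).2 with h | h | h
  · exact Or.inl h
  · exact Or.inr (Or.inl ⟨h.1, h.2.2.1, h.2.2.2⟩)
  · exact Or.inr (Or.inr ⟨h.1, h.2.2⟩)

/-- An empty spot is neither preferred nor crossed. -/
theorem Parks.nocross {n k : ℕ} {a f : Fin n → ℕ} (P : Parks n k a f) (i j : Fin n) (hij : i < j) :
    a i ≠ f j ∧ (a i < f j → f i < f j) ∧ (f j < a i → f j < f i) := by
  have hne : f i ≠ f j := fun h => (ne_of_lt hij) (P.inj h)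
  have hx : ∀ l < i, f l ≠ f j := fun l hl h => (ne_of_lt (hl.trans hij)) (P.inj h)
  have hr := P.rng j
  rcases P.spec i with h | ⟨h1, h2, h3⟩ | ⟨h1, h3⟩
  · omega
  · have : ¬ (f i < f j ∧ f j ≤ a i) := by
      rintro ⟨h4, h5⟩
      obtain ⟨l, hl, he⟩ := h3 _ h4 h5
      exact hx l hl he
    omega
  · have : ¬ (a i ≤ f j + k ∧ f j < f i) := by
      rintro ⟨h4, h5⟩
      obtain ⟨l, hl, he⟩ := h3 _ hr.1 h4 h5
      exact hx l hl he
    omega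

/-- Once a spot has been filled by a car driving forward, no car crosses it backwards. -/
theorem Parks.forward {n k : ℕ} {a f : Fin n → ℕ} (P : Parks n k a f) (i b : Fin n)
    (hi : a i < f i) (hb : f i ≤ a b) : f i ≤ f b := by
  by_contra hlt
  rw [not_le] at hlt
  rcases lt_trichotomy b i with h | h | h
  · have := P.nocross b i h
    omega
  · subst h; omega
  · have hr := P.rng b
    rcases P.spec b with h1 | ⟨h1, h2, h3⟩ | ⟨h1, h3⟩
    · omega
    · rcases P.spec i with g | g | ⟨g1, g2⟩
      · omega
      · omega
      · obtain ⟨l, hl, he⟩ := g2 (f b) hr.1 (by omega) hlt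
        have := P.inj he
        subst this
        exact absurd (hl.trans h) (lt_irrefl _)
    · omega

theorem Parks.card_ge {n k : ℕ} {a f : Fin n → ℕ} (P : Parks n k a f) (j : ℕ) (hj : 1 ≤ j) :
    (Finset.univ.filter (fun i => j ≤ f i)).card = n + 1 - j := by
  rw [← Nat.card_Icc, ← Finset.card_image_of_injective _ P.inj]
  congr 1
  ext x
  simp only [Finset.mem_image, Finset.mem_filter, Finset.mem_univ, true_and, Finset.mem_Icc]
  constructor
  · rintro ⟨i, h, rfl⟩; exact ⟨h, (P.rng i).2⟩
  · rintro ⟨h1, h2⟩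
    obtain ⟨i, rfl⟩ := P.surj x (by omega) h2
    exact ⟨i, h1, rfl⟩

theorem mem_Uset {n : ℕ} {a : Fin n → ℕ} {j : ℕ} :
    j ∈ Uset n a ↔ 1 ≤ j ∧ j ≤ n ∧
      n + 2 - j ≤ (Finset.univ.filter (fun i => j ≤ a i)).card := by
  unfold Uset
  rw [Finset.mem_filter, Finset.mem_Icc]
  unfold ucount
  omega

/-- Basic facts about a maximal interval. -/
theorem maxInterval_facts {n : ℕ} {a : Fin n → ℕ} {p q : ℕ}
    (h : MaxInterval n a p q) :
    2 ≤ p ∧ p ≤ q ∧ q ≤ n ∧ (∀ i, a i ≠ p - 1) ∧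
      (Finset.univ.filter (fun i => p ≤ a i)).card = n + 2 - p ∧
      ∀ j, p ≤ j → j ≤ q → n + 2 - j ≤ (Finset.univ.filter (fun i => j ≤ a i)).card := by
  obtain ⟨hpq, h1, h2, -⟩ := h
  have hU := fun j h3 h4 => mem_Uset.mp (h1 j h3 h4)
  rw [mem_Uset] at h2
  have hp := hU p le_rfl hpq
  have hle : (Finset.univ.filter (fun i => p ≤ a i)).card ≤ n := by
    refine (Finset.card_le_univ _).trans ?_
    simp
  have hp2 : 2 ≤ p := by omega
  have hsub : Finset.univ.filter (fun i => p ≤ a i) ⊆ Finset.univ.filter (fun i => p - 1 ≤ a i) := by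
    intro i hi
    simp only [Finset.mem_filter, Finset.mem_univ, true_and] at hi ⊢
    omega
  have hc := Finset.card_le_card hsub
  have h3 : (Finset.univ.filter (fun i => p - 1 ≤ a i)).card ≤ n + 2 - p := by
    omega
  refine ⟨hp2, hpq, (hU q hpq le_rfl).2.1, ?_, by omega, fun j h4 h5 => (hU j h4 h5).2.2⟩
  intro i hi
  have heq := Finset.eq_of_subset_of_card_le hsub (by omega)
  have : i ∈ Finset.univ.filter (fun i => p ≤ a i) := by
    rw [heq]; simp only [Finset.mem_filter, Finset.mem_univ, true_and]; omega
  simp only [Finset.mem_filter, Finset.mem_univ, true_and] at this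
  omega

/-! ### Restrictions -/

theorem restrict_apply {n : ℕ} (a : Fin n → ℕ) (J : Finset (Fin n)) (w : ℕ) (t : Fin J.card) :
    restrictTranslate n a J w t = a (J.orderEmbOfFin rfl t) - w := rfl

theorem exists_index {n : ℕ} {J : Finset (Fin n)} {i : Fin n} (hi : i ∈ J) :
    ∃ t, J.orderEmbOfFin rfl t = i := by
  have : i ∈ Set.range (J.orderEmbOfFin rfl) := by
    rw [Finset.range_orderEmbOfFin]; exact hi
  exact this

theorem card_restrict {n : ℕ} (a : Fin n → ℕ) (J : Finset (Fin n)) (w j : ℕ) :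
    (Finset.univ.filter (fun t => j ≤ restrictTranslate n a J w t)).card =
      (J.filter (fun i => j ≤ a i - w)).card := by
  rw [← Finset.card_image_of_injective _ (J.orderEmbOfFin rfl).injective]
  congr 1
  ext i
  simp only [Finset.mem_image, Finset.mem_filter, Finset.mem_univ, true_and]
  constructor
  · rintro ⟨t, h, rfl⟩; exact ⟨Finset.orderEmbOfFin_mem J rfl t, h⟩
  · rintro ⟨h1, h2⟩
    obtain ⟨t, rfl⟩ := exists_index h1
    exact ⟨t, h2, rfl⟩

/-- If `g` satisfies the parking rule without forward moves, then all cars park. -/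
theorem naples_of_spec {m k : ℕ} {b g : Fin m → ℕ} (hb : ∀ t, 1 ≤ b t)
    (inj : Function.Injective g) (pos : ∀ t, 1 ≤ g t)
    (spec : ∀ t, g t = b t ∨
      (g t < b t ∧ b t ≤ g t + k ∧ ∀ x, g t < x → x ≤ b t → ∃ s < t, g s = x)) :
    NaplesPF m k b := by
  have key : ∀ N : ℕ, ∀ t : Fin m, t.val < N → outcome m m b (fun _ => k) t = some (g t) := by
    intro N
    induction N with
    | zero => intro t ht; omega
    | succ N ih =>
      intro t ht
      have ih' : ∀ s < t, outcome m m b (fun _ => k) s = some (g s) := fun s hs =>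
        ih s (by have : s.val < t.val := hs; omega)
      rw [outcome_eq_some m m k b t _ (hb t)]
      refine ⟨?_, ?_⟩
      · intro s hs
        rw [ih' s hs]
        intro he
        exact (ne_of_lt hs) (inj (Option.some.inj he))
      · rcases spec t with h | ⟨h1, h2, h3⟩
        · exact Or.inl h
        · refine Or.inr (Or.inl ⟨h1, pos t, h2, ?_⟩)
          intro x hx1 hx2
          obtain ⟨s, hs, rfl⟩ := h3 x hx1 hx2
          exact ⟨s, hs, ih' s hs⟩
  intro t
  show (outcome m m b (fun _ => k) t).isSome
  rw [key (t.val + 1) t (Nat.lt_succ_self _)]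
  rfl

theorem card_split {n : ℕ} (c : Fin n → ℕ) (T : Fin n) (j : ℕ) :
    (Finset.univ.filter (fun i => j ≤ c i)).card =
      (Finset.univ.filter (fun i => i ≤ T ∧ j ≤ c i)).card +
      (Finset.univ.filter (fun i => T < i ∧ j ≤ c i)).card := by
  rw [← Finset.card_union_of_disjoint]
  · congr 1
    ext i
    simp only [Finset.mem_filter, Finset.mem_univ, true_and, Finset.mem_union]
    have := le_or_gt i T
    tauto
  · rw [Finset.disjoint_left]
    intro i hi hi2
    simp only [Finset.mem_filter, Finset.mem_univ, true_and] at hi hi2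
    exact absurd hi.1 (not_le.mpr hi2.1)

/-- The forward direction. -/
theorem forward_dir {n k : ℕ} {a f : Fin n → ℕ} (ha : ∀ i, 1 ≤ a i ∧ a i ≤ n)
    (P : Parks n k a f) {p q : ℕ} (hM : MaxInterval n a p q) :
    ∃ J : Finset (Fin n), q - p + 2 ≤ J.card ∧
      (∀ j ∈ J, a j ∈ Finset.Icc (p - 1) (p - 2 + J.card)) ∧
      Complete J.card (restrictTranslate n a J (p - 2)) ∧
      NaplesPF J.card k (restrictTranslate n a J (p - 2)) := by
  obtain ⟨hp2, hpq, hqn, hpref, hNp, hN⟩ := maxInterval_facts hM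
  -- the car that fills spot `p - 1`
  obtain ⟨T, hT⟩ := P.surj (p - 1) (by omega) (by omega)
  have haT : p ≤ a T := by
    by_contra hlt
    have h1 := hpref T
    have hfw : a T < f T := by omega
    have hsub : Finset.univ.filter (fun i => p ≤ a i) ⊆ Finset.univ.filter (fun i => p ≤ f i) := by
      intro i hi
      simp only [Finset.mem_filter, Finset.mem_univ, true_and] at hi ⊢
      have h2 := P.forward T i hfw (by omega)
      have h3 : f i ≠ f T := by
        intro h; have := P.inj h; subst this; omega
      omega
    have := Finset.card_le_card hsub
    rw [P.card_ge p (by omega)] at this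
    omega
  -- before `T` spot `p - 1` is empty
  have hb : ∀ i < T, (p ≤ a i ↔ p ≤ f i) ∧ f i ≠ p - 1 := by
    intro i hi
    have := P.nocross i T hi
    have h3 : f i ≠ f T := fun h => (ne_of_lt hi) (P.inj h)
    omega
  have hApOp : (Finset.univ.filter (fun i => i ≤ T ∧ p ≤ a i)).card =
      (Finset.univ.filter (fun i => i ≤ T ∧ p ≤ f i)).card + 1 := by
    have hnm : T ∉ Finset.univ.filter (fun i => i ≤ T ∧ p ≤ f i) := by
      simp only [Finset.mem_filter, Finset.mem_univ, true_and]; omega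
    rw [← Finset.card_insert_of_notMem hnm]
    congr 1
    ext i
    simp only [Finset.mem_filter, Finset.mem_univ, true_and, Finset.mem_insert]
    constructor
    · rintro ⟨h1, h2⟩
      rcases eq_or_lt_of_le h1 with h | h
      · exact Or.inl h
      · exact Or.inr ⟨h1, (hb i h).1.mp h2⟩
    · rintro (h | ⟨h1, h2⟩)
      · subst h; exact ⟨le_rfl, haT⟩
      · rcases eq_or_lt_of_le h1 with h | h
        · subst h; exact ⟨h1, haT⟩
        · exact ⟨h1, (hb i h).1.mpr h2⟩
  have hRmono : ∀ j, p ≤ j → (Finset.univ.filter (fun i => T < i ∧ j ≤ a i)).card ≤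
      (Finset.univ.filter (fun i => T < i ∧ p ≤ a i)).card := by
    intro j hj
    apply Finset.card_le_card
    intro i hi
    simp only [Finset.mem_filter, Finset.mem_univ, true_and] at hi ⊢
    exact ⟨hi.1, hj.trans hi.2⟩
  have hSeq : ∀ j, p ≤ j → (∀ i, p ≤ f i → f i < j → i ≤ T) →
      (Finset.univ.filter (fun i => T < i ∧ j ≤ f i)).card =
      (Finset.univ.filter (fun i => T < i ∧ p ≤ f i)).card := by
    intro j hj hful
    congr 1
    ext i
    simp only [Finset.mem_filter, Finset.mem_univ, true_and]
    constructor
    · rintro ⟨h1, h2⟩; exact ⟨h1, hj.trans h2⟩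
    · rintro ⟨h1, h2⟩
      refine ⟨h1, ?_⟩
      by_contra hlt
      exact absurd (hful i h2 (by omega)) (not_le.mpr h1)
  have s1 := card_split a T p
  have s2 := card_split f T p
  rw [P.card_ge p (by omega)] at s2
  -- at time `T` all spots in `[p, q]` are full
  have hfull : ∀ e, p ≤ e → e ≤ q → ∀ i, f i = e → i ≤ T := by
    intro e
    induction e using Nat.strong_induction_on with
    | _ e ih =>
      intro h1 h2 i hi
      by_contra hlt
      rw [not_le] at hlt
      have hAO : (Finset.univ.filter (fun i => i ≤ T ∧ e ≤ a i)).card =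
          (Finset.univ.filter (fun i => i ≤ T ∧ e ≤ f i)).card := by
        congr 1
        ext l
        simp only [Finset.mem_filter, Finset.mem_univ, true_and]
        apply and_congr_right
        intro hl
        have := P.nocross l i (lt_of_le_of_lt hl hlt)
        have h3 : f l ≠ f i := fun h => (ne_of_lt (lt_of_le_of_lt hl hlt)) (P.inj h)
        omega
      have h3 := hSeq e h1 (fun l hl1 hl2 => ih (f l) hl2 hl1 (by omega) l rfl)
      have h4 := hRmono e h1
      have h5 := card_split a T e
      have h6 := card_split f T e
      rw [P.card_ge e (by omega)] at h6
      have h7 := hN e h1 h2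
      omega
  have hcross0 : ∀ j, p ≤ j → j ≤ q → ∃ i ≤ T, j ≤ a i ∧ f i < j := by
    intro j h1 h2
    by_contra hcon
    push Not at hcon
    have hsub : (Finset.univ.filter (fun i => i ≤ T ∧ j ≤ a i)).card ≤
        (Finset.univ.filter (fun i => i ≤ T ∧ j ≤ f i)).card := by
      apply Finset.card_le_card
      intro i hi
      simp only [Finset.mem_filter, Finset.mem_univ, true_and] at hi ⊢
      exact ⟨hi.1, hcon i hi.1 hi.2⟩
    have h3 := hSeq j h1 (fun l hl1 hl2 => hfull (f l) hl1 (by omega) l rfl)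
    have h4 := hRmono j h1
    have h5 := card_split a T j
    have h6 := card_split f T j
    rw [P.card_ge j (by omega)] at h6
    have h7 := hN j h1 h2
    omega
  -- the right end of the block
  have hex : ∃ r, q ≤ r ∧ ∀ i ≤ T, r < a i → r < f i :=
    ⟨n, hqn, fun i _ h => by have := ha i; omega⟩
  obtain ⟨r, ⟨hqr, hr⟩, hmin⟩ : ∃ r, (q ≤ r ∧ ∀ i ≤ T, r < a i → r < f i) ∧
      ∀ r' < r, ¬ (q ≤ r' ∧ ∀ i ≤ T, r' < a i → r' < f i) := by
    classical
    exact ⟨Nat.find hex, Nat.find_spec hex, fun r' h => Nat.find_min hex h⟩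
  have hcross : ∀ j, p ≤ j → j ≤ r → ∃ i ≤ T, j ≤ a i ∧ f i < j := by
    intro j h1 h2
    rcases Nat.lt_or_ge q j with h | h
    · have h3 := hmin (j - 1) (by omega)
      push Not at h3
      obtain ⟨i, hi, h4, h5⟩ := h3 (by omega)
      exact ⟨i, hi, by omega, by omega⟩
    · exact hcross0 j h1 h
  have hrn : r ≤ n := by
    obtain ⟨i, _, h, _⟩ := hcross r (by omega) le_rfl
    exact h.trans (ha i).2
  have hfullr : ∀ i, p - 1 ≤ f i → f i ≤ r → i ≤ T := by
    intro i h1 h2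
    by_contra hlt
    rw [not_le] at hlt
    have h0 : f i ≠ f T := fun h => (ne_of_lt hlt) (P.inj h).symm
    obtain ⟨l, hl, h3, h4⟩ := hcross (f i) (by omega) h2
    have := P.nocross l i (lt_of_le_of_lt hl hlt)
    omega
  have hnf : ∀ i, p - 1 ≤ f i → f i ≤ r → f i ≤ a i := by
    intro i h1 h2
    by_contra hlt
    rw [not_le] at hlt
    rcases Nat.eq_or_lt_of_le h1 with h | h
    · have : i = T := P.inj (by omega)
      subst this; omega
    · obtain ⟨l, hl, h3, h4⟩ := hcross (f i) (by omega) h2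
      have := P.forward i l hlt h3
      omega
  have har : ∀ i, p - 1 ≤ f i → f i ≤ r → a i ≤ r := by
    intro i h1 h2
    by_contra hlt
    have := hr i (hfullr i h1 h2) (by omega)
    omega
  -- the set `J`
  obtain ⟨J, hJ⟩ : ∃ J : Finset (Fin n), ∀ i, i ∈ J ↔ p - 1 ≤ f i ∧ f i ≤ r :=
    ⟨Finset.univ.filter (fun i => p - 1 ≤ f i ∧ f i ≤ r), by simp⟩
  have hblock : ∀ j, p - 1 ≤ j → (J.filter (fun i => j ≤ f i)).card = r + 1 - j := by
    intro j hj
    rw [← Nat.card_Icc, ← Finset.card_image_of_injective _ P.inj]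
    congr 1
    ext x
    simp only [Finset.mem_image, Finset.mem_filter, Finset.mem_Icc, hJ]
    constructor
    · rintro ⟨i, h, rfl⟩; exact ⟨h.2, h.1.2⟩
    · rintro ⟨h1, h2⟩
      obtain ⟨i, rfl⟩ := P.surj x (by omega) (by omega)
      exact ⟨i, ⟨⟨by omega, h2⟩, h1⟩, rfl⟩
  have hcard : J.card = r + 2 - p := by
    have h1 := hblock (p - 1) le_rfl
    rw [Finset.filter_true_of_mem (fun i hi => ((hJ i).mp hi).1)] at h1
    omega
  refine ⟨J, by omega, ?_, ?_, ?_⟩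
  · intro j hj
    have h1 := (hJ j).mp hj
    have h2 := hnf j h1.1 h1.2
    have h3 := har j h1.1 h1.2
    rw [Finset.mem_Icc]; omega
  · unfold Complete
    ext j
    rw [mem_Uset, Finset.mem_Icc, card_restrict]
    constructor
    · rintro ⟨h1, h2, h3⟩
      have := Finset.card_filter_le J (fun i => j ≤ a i - (p - 2))
      omega
    · rintro ⟨h1, h2⟩
      refine ⟨by omega, h2, ?_⟩
      obtain ⟨l, hl, h3, h4⟩ := hcross (j + (p - 2)) (by omega) (by omega)
      have hlp : p - 1 ≤ f l := by
        rcases eq_or_lt_of_le hl with h | h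
        · subst h; omega
        · have := (hb l h).1.mp (by omega)
          omega
      have hlJ : l ∈ J := (hJ l).mpr ⟨hlp, by omega⟩
      have hnm : l ∉ J.filter (fun i => j + (p - 2) ≤ f i) := by
        simp only [Finset.mem_filter]; omega
      have hsub : insert l (J.filter (fun i => j + (p - 2) ≤ f i)) ⊆
          J.filter (fun i => j ≤ a i - (p - 2)) := by
        intro i hi
        rw [Finset.mem_insert, Finset.mem_filter] at hi
        rw [Finset.mem_filter]
        rcases hi with h | ⟨h5, h6⟩
        · subst h; exact ⟨hlJ, by omega⟩
        · have h7 := (hJ i).mp h5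
          have := hnf i h7.1 h7.2
          exact ⟨h5, by omega⟩
      have h8 := Finset.card_le_card hsub
      rw [Finset.card_insert_of_notMem hnm, hblock _ (by omega)] at h8
      omega
  · have hmem : ∀ t, p - 1 ≤ f (J.orderEmbOfFin rfl t) ∧ f (J.orderEmbOfFin rfl t) ≤ r :=
      fun t => (hJ _).mp (Finset.orderEmbOfFin_mem J rfl t)
    refine naples_of_spec (g := fun t => f (J.orderEmbOfFin rfl t) - (p - 2)) ?_ ?_ ?_ ?_
    · intro t
      have h1 := hmem t
      have h2 := hnf _ h1.1 h1.2
      rw [restrict_apply]; omega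
    · intro t s hts
      have h1 := hmem t
      have h2 := hmem s
      have hts' : f (J.orderEmbOfFin rfl t) - (p - 2) = f (J.orderEmbOfFin rfl s) - (p - 2) := hts
      exact (J.orderEmbOfFin rfl).injective (P.inj (by omega))
    · intro t
      have h1 := hmem t
      show 1 ≤ f (J.orderEmbOfFin rfl t) - (p - 2)
      omega
    · intro t
      have h1 := hmem t
      have h2 := hnf _ h1.1 h1.2
      have h3 := har _ h1.1 h1.2
      simp only [restrict_apply]
      rcases P.spec (J.orderEmbOfFin rfl t) with h | ⟨h4, h5, h6⟩ | h
      · left; omega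
      · right
        refine ⟨by omega, by omega, ?_⟩
        intro x hx1 hx2
        obtain ⟨l, hl, hfl⟩ := h6 (x + (p - 2)) (by omega) (by omega)
        obtain ⟨s, rfl⟩ := exists_index ((hJ l).mpr ⟨by omega, by omega⟩)
        exact ⟨s, (J.orderEmbOfFin rfl).lt_iff_lt.mp hl, by omega⟩
      · omega

/-! ### The backward direction -/

theorem exists_maxInterval {n : ℕ} {a : Fin n → ℕ} {c : ℕ} (hc : c ∈ Uset n a) :
    ∃ p q, p ≤ c ∧ c ≤ q ∧ MaxInterval n a p q := by
  classical
  have hex1 : ∃ p, ∀ j, p ≤ j → j ≤ c → j ∈ Uset n a :=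
    ⟨c, fun j h1 h2 => by have : j = c := by omega
                          subst this; exact hc⟩
  have hex2 : ∃ q, c ≤ q ∧ q + 1 ∉ Uset n a :=
    ⟨n, (mem_Uset.mp hc).2.1, fun h => by have := (mem_Uset.mp h).2.1; omega⟩
  obtain ⟨p, hp, hpm⟩ : ∃ p, (∀ j, p ≤ j → j ≤ c → j ∈ Uset n a) ∧
      ∀ p' < p, ¬ (∀ j, p' ≤ j → j ≤ c → j ∈ Uset n a) :=
    ⟨Nat.find hex1, Nat.find_spec hex1, fun r' h => Nat.find_min hex1 h⟩
  obtain ⟨q, ⟨hq1, hq2⟩, hqm⟩ : ∃ q, (c ≤ q ∧ q + 1 ∉ Uset n a) ∧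
      ∀ q' < q, ¬ (c ≤ q' ∧ q' + 1 ∉ Uset n a) :=
    ⟨Nat.find hex2, Nat.find_spec hex2, fun r' h => Nat.find_min hex2 h⟩
  have hpc : p ≤ c := by
    by_contra hlt
    exact hpm c (by omega) (fun j h1 h2 => by
      have : j = c := by omega
      subst this; exact hc)
  have hp1 : 1 ≤ p := by
    by_contra hlt
    have := (mem_Uset.mp (hp 0 (by omega) (by omega))).1
    omega
  refine ⟨p, q, hpc, hq1, by omega, ?_, ?_, hq2⟩
  · intro j h1 h2
    rcases Nat.lt_or_ge c j with h | h
    · have h3 := hqm (j - 1) (by omega)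
      by_contra hj
      apply h3
      refine ⟨by omega, ?_⟩
      rwa [Nat.sub_add_cancel (by omega)]
    · exact hp j h1 h
  · intro hmem
    apply hpm (p - 1) (by omega)
    intro j h1 h2
    rcases Nat.eq_or_lt_of_le h1 with h | h
    · rwa [← h]
    · exact hp j (by omega) h2

theorem backward_dir {n k : ℕ} {a : Fin n → ℕ} (ha : ∀ i, 1 ≤ a i ∧ a i ≤ n)
    (hall : ∀ p q, MaxInterval n a p q →
        ∃ J : Finset (Fin n), q - p + 2 ≤ J.card ∧
          (∀ j ∈ J, a j ∈ Finset.Icc (p - 1) (p - 2 + J.card)) ∧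
          Complete J.card (restrictTranslate n a J (p - 2)) ∧
          NaplesPF J.card k (restrictTranslate n a J (p - 2))) :
    NaplesPF n k a := by
  by_contra hnot
  obtain ⟨o, ho⟩ : ∃ o, o = outcome n n a (fun _ => k) := ⟨_, rfl⟩
  have hsome := fun i s => outcome_eq_some n n k a i s (ha i).1
  have hnone := fun i => outcome_eq_none n n k a i
  rw [← ho] at hsome hnone
  obtain ⟨i0, hi0⟩ : ∃ i0, o i0 = none := by
    by_contra hcon
    push Not at hcon
    apply hnot
    intro i
    rw [← ho]
    exact Option.isSome_iff_ne_none.mpr (hcon i)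
  -- the largest empty spot
  have hempty : ((Finset.Icc 1 n).filter (fun x => ∀ i, o i ≠ some x)).Nonempty := by
    by_contra hcon
    simp only [Finset.not_nonempty_iff_eq_empty, Finset.filter_eq_empty_iff, Finset.mem_Icc] at hcon
    push Not at hcon
    have hsub : Finset.Icc 1 n ⊆ (Finset.univ.erase i0).image (fun i => (o i).getD 0) := by
      intro x hx
      obtain ⟨i, hi⟩ := hcon (Finset.mem_Icc.mp hx)
      simp only [Finset.mem_image, Finset.mem_erase, Finset.mem_univ, and_true]
      refine ⟨i, ?_, by rw [hi]; rfl⟩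
      rintro rfl
      rw [hi0] at hi
      exact absurd hi (by simp)
    have h1 := Finset.card_le_card hsub
    have h2 := Finset.card_image_le (s := Finset.univ.erase i0) (f := fun i => (o i).getD 0)
    rw [Finset.card_erase_of_mem (Finset.mem_univ _), Finset.card_univ, Fintype.card_fin] at h2
    rw [Nat.card_Icc] at h1
    have := i0.isLt
    omega
  obtain ⟨s, hs1, hsn, hsE, hsmax⟩ : ∃ s, 1 ≤ s ∧ s ≤ n ∧ (∀ i, o i ≠ some s) ∧
      ∀ x, s < x → x ≤ n → ∃ i, o i = some x := by
    obtain ⟨s, h1, h2⟩ := Finset.exists_max_image _ id hempty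
    simp only [Finset.mem_filter, Finset.mem_Icc, id] at h1 h2
    refine ⟨s, h1.1.1, h1.1.2, h1.2, ?_⟩
    intro x hx1 hx2
    by_contra hcon
    push Not at hcon
    have := h2 x ⟨⟨by omega, hx2⟩, hcon⟩
    omega
  have hpref : ∀ i, a i ≠ s := by
    intro i hi
    apply hsE i
    rw [hsome]
    exact ⟨fun j _ => hsE j, Or.inl hi.symm⟩
  have hgt : ∀ i x, o i = some x → s < x → s < a i := by
    intro i x hi hx
    rcases ((hsome i x).mp hi).2 with h | h | ⟨h1, h2, h3⟩
    · omega
    · omega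
    · by_contra hlt
      obtain ⟨j, _, hj⟩ := h3 s hs1 (by omega) hx
      exact hsE j hj
  have hgt0 : s < a i0 := by
    by_contra hlt
    obtain ⟨j, _, hj⟩ := hnone i0 hi0 s (by omega) hsn
    exact hsE j hj
  have hsn' : s < n := lt_of_lt_of_le hgt0 (ha i0).2
  have hU : s + 1 ∈ Uset n a := by
    rw [mem_Uset]
    refine ⟨by omega, by omega, ?_⟩
    have hsub : Finset.Icc (s + 1) n ⊆ ((Finset.univ.filter (fun i => s + 1 ≤ a i)).erase i0).image
        (fun i => (o i).getD 0) := by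
      intro x hx
      rw [Finset.mem_Icc] at hx
      obtain ⟨i, hi⟩ := hsmax x (by omega) hx.2
      simp only [Finset.mem_image, Finset.mem_erase, Finset.mem_filter, Finset.mem_univ, true_and]
      refine ⟨i, ⟨?_, hgt i x hi (by omega)⟩, by rw [hi]; rfl⟩
      rintro rfl
      rw [hi0] at hi
      exact absurd hi (by simp)
    have h1 := Finset.card_le_card hsub
    have h2 := Finset.card_image_le (s := (Finset.univ.filter (fun i => s + 1 ≤ a i)).erase i0)
      (f := fun i => (o i).getD 0)
    have hmem : i0 ∈ Finset.univ.filter (fun i => s + 1 ≤ a i) := by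
      simp only [Finset.mem_filter, Finset.mem_univ, true_and]; omega
    have h3 := Finset.card_erase_add_one hmem
    rw [Nat.card_Icc] at h1
    omega
  obtain ⟨p, q, hps, hsq, hM⟩ := exists_maxInterval hU
  obtain ⟨hp2, hpq, hqn, -, hNp, -⟩ := maxInterval_facts hM
  obtain ⟨J, hJc, hJr, hJcomp, hJN⟩ := hall p q hM
  -- the length of the block is at most `n - p + 2`
  have hcomp : ∀ j, 2 ≤ j → j ≤ J.card → J.card + 2 - j ≤
      (Finset.univ.filter (fun t => j ≤ restrictTranslate n a J (p - 2) t)).card := by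
    intro j h1 h2
    have : j ∈ Uset J.card (restrictTranslate n a J (p - 2)) := by
      rw [hJcomp]; exact Finset.mem_Icc.mpr ⟨h1, h2⟩
    exact (mem_Uset.mp this).2.2
  have hrn : J.card + p ≤ n + 2 := by
    have h1 := hcomp 2 le_rfl (by omega)
    rw [card_restrict] at h1
    have h2 : (J.filter (fun i => 2 ≤ a i - (p - 2))).card ≤
        (Finset.univ.filter (fun i => p ≤ a i)).card := by
      apply Finset.card_le_card
      intro i hi
      simp only [Finset.mem_filter, Finset.mem_univ, true_and] at hi ⊢
      omega
    omega
  obtain ⟨b, hbdef⟩ : ∃ b, b = restrictTranslate n a J (p - 2) := ⟨_, rfl⟩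
  rw [← hbdef] at hJcomp hJN hcomp
  have hab : ∀ t, a (J.orderEmbOfFin rfl t) = b t + (p - 2) ∧ 1 ≤ b t ∧ b t ≤ J.card := by
    intro t
    have h1 := Finset.mem_Icc.mp (hJr _ (Finset.orderEmbOfFin_mem J rfl t))
    rw [hbdef, restrict_apply]
    omega
  obtain ⟨g, P, -⟩ := naples_parks (fun t => (hab t).2) hJN
  obtain ⟨t0, ht0⟩ := P.surj (s - (p - 2)) (by omega) (by omega)
  rcases Nat.lt_trichotomy (b t0) (g t0) with h | h | h
  · -- the spot is filled by a car driving forward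
    have h1 := hcomp (g t0 + 1) (by omega) (by omega)
    have hsub : Finset.univ.filter (fun t => g t0 + 1 ≤ b t) ⊆
        Finset.univ.filter (fun t => g t0 + 1 ≤ g t) := by
      intro t ht
      simp only [Finset.mem_filter, Finset.mem_univ, true_and] at ht ⊢
      have h2 := P.forward t0 t h (by omega)
      have h3 : g t ≠ g t0 := by
        intro he; have := P.inj he; subst this; omega
      omega
    have h4 := Finset.card_le_card hsub
    rw [P.card_ge _ (by omega)] at h4
    omega
  · have := hpref (J.orderEmbOfFin rfl t0)
    have := hab t0
    omega
  · -- the spot is filled by a car backing up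
    have hmono : ∀ N : ℕ, ∀ t : Fin J.card, t.val < N → t < t0 → g t0 < g t →
        ∃ i, i ≤ J.orderEmbOfFin rfl t ∧ o i = some (g t + (p - 2)) := by
      intro N
      induction N with
      | zero => intro t ht; omega
      | succ N ih =>
        intro t htN htt hgt'
        by_contra hcon
        push Not at hcon
        have hprev : ∀ u < t, g t0 < g u →
            ∃ i, i < J.orderEmbOfFin rfl t ∧ o i = some (g u + (p - 2)) := by
          intro u hu hgu
          obtain ⟨i, hi, hoi⟩ := ih u (by have : u.val < t.val := hu; omega) (hu.trans htt) hgu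
          exact ⟨i, lt_of_le_of_lt hi ((J.orderEmbOfFin rfl).lt_iff_lt.mpr hu), hoi⟩
        apply hcon _ le_rfl
        rw [hsome]
        refine ⟨fun j hj => hcon j hj.le, ?_⟩
        have hat := hab t
        have hgr := P.rng t
        rcases P.spec t with h1 | ⟨h1, h2, h3⟩ | ⟨h1, h3⟩
        · left; omega
        · right; left
          refine ⟨by omega, by omega, by omega, ?_⟩
          intro x hx1 hx2
          obtain ⟨u, hu, hgu⟩ := h3 (x - (p - 2)) (by omega) (by omega)
          obtain ⟨i, hi, hoi⟩ := hprev u hu (by omega)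
          refine ⟨i, hi, ?_⟩
          rw [hoi]; congr 1; omega
        · right; right
          have hfar : g t0 + k < b t := by
            by_contra hle
            obtain ⟨u, hu, hgu⟩ := h3 (g t0) (P.rng t0).1 (by omega) hgt'
            have := P.inj hgu
            subst this
            exact absurd (hu.trans htt) (lt_irrefl _)
          refine ⟨by omega, by omega, ?_⟩
          intro x hx1 hx2 hx3
          obtain ⟨u, hu, hgu⟩ := h3 (x - (p - 2)) (by omega) (by omega) (by omega)
          obtain ⟨i, hi, hoi⟩ := hprev u hu (by omega)
          refine ⟨i, hi, ?_⟩
          rw [hoi]; congr 1; omega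
    rcases P.spec t0 with h1 | ⟨h1, h2, h3⟩ | ⟨h1, h3⟩
    · omega
    · apply hsE (J.orderEmbOfFin rfl t0)
      rw [hsome]
      have hat := hab t0
      refine ⟨fun j _ => hsE j, Or.inr (Or.inl ⟨by omega, hs1, by omega, ?_⟩)⟩
      intro x hx1 hx2
      obtain ⟨u, hu, hgu⟩ := h3 (x - (p - 2)) (by omega) (by omega)
      obtain ⟨i, hi, hoi⟩ := hmono (u.val + 1) u (Nat.lt_succ_self _) hu (by omega)
      refine ⟨i, lt_of_le_of_lt hi ((J.orderEmbOfFin rfl).lt_iff_lt.mpr hu), ?_⟩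
      rw [hoi]; congr 1; omega
    · omega

/-- `α ∈ PF_{n,k}` iff for every maximal interval `[p,q]` of `U_α`
there is `J ⊆ [n]` with `|J| ≥ q−p+2`, `a_j ∈ [p−1, p−2+|J|]` for all `j ∈ J`,
and `τ_{p−2}(α|_J)` a complete `k`-Naples parking function of length `|J|`. -/
theorem statement13 (n k : ℕ) (hn : 1 ≤ n) (hk : 1 ≤ k) (a : Fin n → ℕ)
    (ha : ∀ i, a i ∈ Finset.Icc 1 n) :
    NaplesPF n k a ↔
      ∀ p q, MaxInterval n a p q →
        ∃ J : Finset (Fin n), q - p + 2 ≤ J.card ∧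
          (∀ j ∈ J, a j ∈ Finset.Icc (p - 1) (p - 2 + J.card)) ∧
          Complete J.card (restrictTranslate n a J (p - 2)) ∧
          NaplesPF J.card k (restrictTranslate n a J (p - 2)) := by
  have ha' : ∀ i, 1 ≤ a i ∧ a i ≤ n := fun i => Finset.mem_Icc.mp (ha i)
  constructor
  · intro h p q hM
    obtain ⟨f, P, -⟩ := naples_parks ha' h
    exact forward_dir ha' P hM
  · exact backward_dir ha'
end

section
/- Let n ≥ 1 and α ∈ [n]^n. For each j ∈ U_α, let T̃_j be the set of the last u_α(j) indices i ∈ [n] with a_i ≥ j (i.e. the u_α(j) largest such indices), and let T̃ = ∪_{j ∈ U_α} T̃_j. Then: (a) every vector ρ ∈ {0,n}^n with (α,ρ) ∈ PR_n satisfies |{i ∈ [n] : r_i = n}| ≥ |T̃|, i.e. |ρ| ≥ n·|T̃|; and (b) the vector ρ' ∈ {0,n}^n defined by r_i' = n if i ∈ T̃ and r_i' = 0 otherwise satisfies (α,ρ') ∈ PR_n. -/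
open Finset

/-- `T̃_j`: the set of the last `u_α(j)` indices `i` with `a_i ≥ j`, i.e. those
`i` with `a_i ≥ j` having fewer than `u_α(j)` later indices `h > i` with `a_h ≥ j`. -/
def lastSet (n : ℕ) (a : Fin n → ℕ) (j : ℕ) : Finset (Fin n) :=
  Finset.univ.filter (fun i : Fin n => j ≤ a i ∧
    ((Finset.univ.filter (fun h : Fin n => i < h ∧ j ≤ a h)).card : ℤ) < ucount n a j)

/-- `T̃ = ∪_{j ∈ U_α} T̃_j`. -/
def Ttilde (n : ℕ) (a : Fin n → ℕ) : Finset (Fin n) :=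
  (Uset n a).biUnion (fun j => lastSet n a j)

lemma s18_spec {n : ℕ} {occ : Finset ℕ} {p r s : ℕ} (hp : 1 ≤ p) (hpn : p ≤ n)
    (h : parkSpot n occ p r = some s) :
    s ∉ occ ∧ 1 ≤ s ∧ s ≤ n ∧ (∀ x, s < x → x ≤ p → x ∈ occ) ∧
      (∀ x, p ≤ x → x < s → x ∈ occ) ∧ (r = 0 → p ≤ s) ∧
      (r = n → p < s → ∀ x, 1 ≤ x → x ≤ p → x ∈ occ) := by
  unfold parkSpot at h
  split_ifs at h with h1 hb hf
  · have hm := Finset.max'_mem _ hb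
    have hmax : ∀ x ∈ (Finset.Ico (max 1 (p - r)) p).filter (fun j => j ∉ occ),
        x ≤ ((Finset.Ico (max 1 (p - r)) p).filter (fun j => j ∉ occ)).max' hb :=
      fun x hx => Finset.le_max' _ x hx
    simp only [Option.some.injEq] at h
    rw [h] at hm hmax
    simp only [Finset.mem_filter, Finset.mem_Ico] at hm hmax
    refine ⟨hm.2, by omega, by omega, ?_, ?_, by omega, by omega⟩
    · intro x hx hxp
      by_contra hc
      rcases eq_or_lt_of_le hxp with rfl | hlt
      · exact hc h1
      · have := hmax x ⟨⟨by omega, hlt⟩, hc⟩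
        omega
    · intro x hx hxs; omega
  · have hm := Finset.min'_mem _ hf
    have hmin : ∀ x ∈ (Finset.Ioc p n).filter (fun j => j ∉ occ),
        ((Finset.Ioc p n).filter (fun j => j ∉ occ)).min' hf ≤ x :=
      fun x hx => Finset.min'_le _ x hx
    simp only [Option.some.injEq] at h
    rw [h] at hm hmin
    simp only [Finset.mem_filter, Finset.mem_Ioc] at hm hmin
    refine ⟨hm.2, by omega, by omega, by intro x _ _; omega, ?_, by omega, ?_⟩
    · intro x hx hxs
      by_contra hc
      rcases eq_or_lt_of_le hx with rfl | hlt
      · exact hc h1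
      · have := hmin x ⟨⟨hlt, by omega⟩, hc⟩
        omega
    · intro hr _ x hx hxp
      by_contra hc
      rcases eq_or_lt_of_le hxp with rfl | hlt
      · exact hc h1
      · exact hb ⟨x, by simp only [Finset.mem_filter, Finset.mem_Ico]; exact ⟨⟨by omega, hlt⟩, hc⟩⟩
  · simp only [Option.some.injEq] at h
    subst h
    exact ⟨h1, hp, hpn, by intro x _ _; omega, by intro x _ _; omega, by omega, by omega⟩

lemma s18_none {n : ℕ} {occ : Finset ℕ} {p r : ℕ}
    (h : parkSpot n occ p r = none) :
    (∀ x, p ≤ x → x ≤ n → x ∈ occ) ∧ (r = n → p ≤ n → ∀ x, 1 ≤ x → x ≤ n → x ∈ occ) := by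
  unfold parkSpot at h
  split_ifs at h with h1 hb hf
  have hA : ∀ x, p ≤ x → x ≤ n → x ∈ occ := by
    intro x hx hxn
    by_contra hc
    rcases eq_or_lt_of_le hx with rfl | hlt
    · exact hc h1
    · exact hf ⟨x, by simp only [Finset.mem_filter, Finset.mem_Ioc]; exact ⟨⟨hlt, hxn⟩, hc⟩⟩
  refine ⟨hA, ?_⟩
  intro hr hpn x hx hxn
  by_contra hc
  rcases Nat.lt_or_ge x p with hlt | hge
  · exact hb ⟨x, by simp only [Finset.mem_filter, Finset.mem_Ico]; exact ⟨⟨by omega, hlt⟩, hc⟩⟩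
  · exact hc (hA x hge hxn)

lemma s18_succ {n : ℕ} {a r : Fin n → ℕ} {k : ℕ} (h : k < n) {s : ℕ}
    (hs : outcome n n a r ⟨k, h⟩ = some s) :
    occUpTo n n a r (k + 1) = insert s (occUpTo n n a r k) := by
  unfold outcome at hs
  simp only [occUpTo, h, dite_true] at hs ⊢
  rw [hs]

lemma s18_succ_none {n : ℕ} {a r : Fin n → ℕ} {k : ℕ} (h : k < n)
    (hs : outcome n n a r ⟨k, h⟩ = none) :
    occUpTo n n a r (k + 1) = occUpTo n n a r k := by
  unfold outcome at hs
  simp only [occUpTo, h, dite_true] at hs ⊢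
  rw [hs]

lemma s18_mono {n : ℕ} {a r : Fin n → ℕ} {k l : ℕ} (h : k ≤ l) :
    occUpTo n n a r k ⊆ occUpTo n n a r l := by
  induction l, h using Nat.le_induction with
  | base => exact subset_rfl
  | succ l hl ih =>
    by_cases hln : l < n
    · cases ho : outcome n n a r ⟨l, hln⟩ with
      | none => rw [s18_succ_none hln ho]; exact ih
      | some s => rw [s18_succ hln ho]; exact ih.trans (Finset.subset_insert _ _)
    · simp only [occUpTo, hln, dite_false]; exact ih

lemma s18_cnt {n : ℕ} (P : Fin n → Prop) [DecidablePred P] {k : ℕ} (h : k < n) :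
    (univ.filter (fun i : Fin n => i.val < k + 1 ∧ P i)).card =
    (univ.filter (fun i : Fin n => i.val < k ∧ P i)).card + if P ⟨k, h⟩ then 1 else 0 := by
  by_cases hP : P ⟨k, h⟩
  · have : univ.filter (fun i : Fin n => i.val < k + 1 ∧ P i) =
        insert ⟨k, h⟩ (univ.filter (fun i : Fin n => i.val < k ∧ P i)) := by
      ext i
      simp only [mem_filter, mem_univ, true_and, mem_insert, Fin.ext_iff]
      constructor
      · rintro ⟨h1, h2⟩
        by_cases hk : i.val = k
        · exact Or.inl hk
        · exact Or.inr ⟨by omega, h2⟩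
      · rintro (h1 | ⟨h1, h2⟩)
        · have : i = ⟨k, h⟩ := Fin.ext h1
          subst this
          exact ⟨by simp, hP⟩
        · exact ⟨by omega, h2⟩
    rw [this, card_insert_of_notMem (by simp), if_pos hP]
  · rw [if_neg hP, add_zero]
    congr 1
    ext i
    simp only [mem_filter, mem_univ, true_and]
    constructor
    · rintro ⟨h1, h2⟩
      refine ⟨?_, h2⟩
      by_contra hk
      have : i = ⟨k, h⟩ := Fin.ext (by simp; omega)
      subst this
      exact hP h2
    · rintro ⟨h1, h2⟩
      exact ⟨by omega, h2⟩

lemma s18_sub {n : ℕ} {a r : Fin n → ℕ} (ha : ∀ i, a i ∈ Finset.Icc 1 n) {k : ℕ} (hk : k ≤ n) :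
    occUpTo n n a r k ⊆ Icc 1 n ∧ (occUpTo n n a r k).card ≤ k := by
  induction k with
  | zero => simp [occUpTo]
  | succ k ih =>
    have hkn : k < n := hk
    obtain ⟨i1, i2⟩ := ih (by omega)
    cases ho : outcome n n a r ⟨k, hkn⟩ with
    | none => rw [s18_succ_none hkn ho]; exact ⟨i1, by omega⟩
    | some s =>
      rw [s18_succ hkn ho]
      have hp := ha ⟨k, hkn⟩
      rw [mem_Icc] at hp
      have := s18_spec hp.1 hp.2 ho
      refine ⟨?_, (card_insert_le _ _).trans (by omega)⟩
      rw [insert_subset_iff]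
      exact ⟨by rw [mem_Icc]; omega, i1⟩

/-- cars do not cross a free spot -/
lemma s18_cross {n : ℕ} {a r : Fin n → ℕ} (ha : ∀ i, a i ∈ Finset.Icc 1 n) {q k : ℕ} (hk : k ≤ n)
    (hq : q ∉ occUpTo n n a r k) :
    ((occUpTo n n a r k).filter (fun x => q < x)).card ≤
      (univ.filter (fun i : Fin n => i.val < k ∧ q < a i)).card ∧
    (AllPark n n a r → ((occUpTo n n a r k).filter (fun x => q < x)).card =
      (univ.filter (fun i : Fin n => i.val < k ∧ q < a i)).card) := by
  induction k with
  | zero => simp [occUpTo]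
  | succ k ih =>
    have hkn : k < n := hk
    have hq' : q ∉ occUpTo n n a r k := fun h => hq (s18_mono (Nat.le_succ k) h)
    obtain ⟨i1, i2⟩ := ih (by omega) hq'
    rw [s18_cnt (fun i => q < a i) hkn]
    cases ho : outcome n n a r ⟨k, hkn⟩ with
    | none =>
      rw [s18_succ_none hkn ho]
      refine ⟨by omega, ?_⟩
      intro hA
      have := hA ⟨k, hkn⟩
      rw [ho] at this
      simp at this
    | some s =>
      rw [s18_succ hkn ho] at hq ⊢
      have hp := ha ⟨k, hkn⟩
      rw [mem_Icc] at hp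
      obtain ⟨h1, h2, h3, h4, h5, -, -⟩ := s18_spec hp.1 hp.2 ho
      have hqs : q ≠ s := by
        rintro rfl
        exact hq (mem_insert_self _ _)
      have key : q < a ⟨k, hkn⟩ ↔ q < s := by
        constructor
        · intro h
          by_contra hc
          exact hq' (h4 q (by omega) (by omega))
        · intro h
          by_contra hc
          exact hq' (h5 q (by omega) (by omega))
      rw [filter_insert]
      by_cases hs : q < s
      · rw [if_pos hs, if_pos (key.2 hs), card_insert_of_notMem (by simp [h1])]
        exact ⟨by omega, fun hA => by rw [i2 hA]⟩
      · rw [if_neg hs, if_neg (fun h => hs (key.1 h))]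
        exact ⟨by omega, fun hA => by rw [i2 hA, add_zero]⟩

lemma s18_mem {n : ℕ} {a : Fin n → ℕ} (ha : ∀ i, a i ∈ Finset.Icc 1 n) (i : Fin n) :
    i ∈ Ttilde n a ↔ ∃ j, 1 ≤ j ∧ j ≤ a i ∧
      n + 1 ≤ (univ.filter (fun h : Fin n => h.val < i.val ∧ j ≤ a h)).card + j := by
  have hp := ha i
  rw [mem_Icc] at hp
  have key : ∀ j, j ≤ a i → (univ.filter (fun h : Fin n => j ≤ a h)).card =
      (univ.filter (fun h : Fin n => h.val < i.val ∧ j ≤ a h)).card + 1 +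
      (univ.filter (fun h : Fin n => i < h ∧ j ≤ a h)).card := by
    intro j hj
    have e1 := s18_cnt (fun h => j ≤ a h) i.isLt
    rw [if_pos hj] at e1
    rw [← e1, ← card_union_of_disjoint]
    · congr 1
      ext h
      simp only [mem_filter, mem_univ, true_and, mem_union, Fin.lt_def]
      constructor
      · intro hh
        rcases Nat.lt_or_ge i.val h.val with h1 | h1
        · exact Or.inr ⟨h1, hh⟩
        · exact Or.inl ⟨by omega, hh⟩
      · rintro (hh | hh) <;> exact hh.2
    · rw [disjoint_left]
      intro h
      simp only [mem_filter, mem_univ, true_and, Fin.lt_def]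
      omega
  simp only [Ttilde, Uset, lastSet, mem_biUnion, mem_filter, mem_Icc, mem_univ, true_and]
  simp only [ucount]
  constructor
  · rintro ⟨j, ⟨⟨h1, h2⟩, h3⟩, h4, h5⟩
    have := key j h4
    exact ⟨j, h1, h4, by omega⟩
  · rintro ⟨j, h1, h2, h3⟩
    have := key j h2
    exact ⟨j, ⟨⟨h1, by omega⟩, by omega⟩, h2, by omega⟩

/-- If the tail of the street from the preference of car `i` is full, then `i ∈ T̃`. -/
lemma s18_full_mem {n : ℕ} {a r : Fin n → ℕ} (ha : ∀ i, a i ∈ Finset.Icc 1 n) (i : Fin n)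
    (hf : ∀ x, a i ≤ x → x ≤ n → x ∈ occUpTo n n a r i.val) : i ∈ Ttilde n a := by
  have hp := ha i
  rw [mem_Icc] at hp
  rw [s18_mem ha]
  obtain ⟨hsub, hcard⟩ := s18_sub (r := r) ha i.isLt.le
  have hne : (Icc 1 n \ occUpTo n n a r i.val).Nonempty := by
    rw [← card_pos, card_sdiff_of_subset hsub, Nat.card_Icc]
    have := i.isLt
    omega
  set q := (Icc 1 n \ occUpTo n n a r i.val).max' hne with hqdef
  have hq := max'_mem _ hne
  rw [← hqdef, mem_sdiff, mem_Icc] at hq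
  have hmax : ∀ x, q < x → x ≤ n → x ∈ occUpTo n n a r i.val := by
    intro x hx hxn
    by_contra hc
    have := le_max' (Icc 1 n \ occUpTo n n a r i.val) x
      (by rw [mem_sdiff, mem_Icc]; exact ⟨by omega, hc⟩)
    omega
  have hqa : q < a i := by
    by_contra hc
    exact hq.2 (hf q (by omega) hq.1.2)
  refine ⟨q + 1, by omega, hqa, ?_⟩
  have h1 := (s18_cross ha i.isLt.le hq.2).1
  have h2 : (Ioc q n).card ≤ ((occUpTo n n a r i.val).filter (fun x => q < x)).card := by
    apply card_le_card
    intro x hx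
    rw [mem_Ioc] at hx
    rw [mem_filter]
    exact ⟨hmax x hx.1 hx.2, hx.1⟩
  rw [Nat.card_Ioc] at h2
  simp only [Nat.succ_le_iff]
  omega

/-- Part (b). -/
lemma s18_b {n : ℕ} {a : Fin n → ℕ} (ha : ∀ i, a i ∈ Finset.Icc 1 n) :
    AllPark n n a (fun i => if i ∈ Ttilde n a then n else 0) := by
  intro i
  have hp := ha i
  rw [mem_Icc] at hp
  by_contra hc
  rw [Option.not_isSome_iff_eq_none] at hc
  obtain ⟨h1, h2⟩ := s18_none hc
  have hT := s18_full_mem ha i h1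
  have h3 := h2 (by simp [hT]) hp.2
  have h4 : Icc 1 n ⊆ occUpTo n n a (fun i => if i ∈ Ttilde n a then n else 0) i.val := by
    intro x hx
    rw [mem_Icc] at hx
    exact h3 x hx.1 hx.2
  have h5 := card_le_card h4
  have h6 := (s18_sub (r := fun i => if i ∈ Ttilde n a then n else 0) ha i.isLt.le).2
  rw [Nat.card_Icc] at h5
  have := i.isLt
  omega

/-- If `i ∈ T̃`, the tail from the preference of car `i` is full in the `T̃`-process. -/
lemma s18_mem_full {n : ℕ} {a : Fin n → ℕ} (ha : ∀ i, a i ∈ Finset.Icc 1 n) :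
    ∀ k : ℕ, ∀ h : k < n, (⟨k, h⟩ : Fin n) ∈ Ttilde n a → ∀ x, a ⟨k, h⟩ ≤ x → x ≤ n →
      x ∈ occUpTo n n a (fun i => if i ∈ Ttilde n a then n else 0) k := by
  intro k
  induction k using Nat.strong_induction_on with
  | _ k ih =>
  intro hk hT q hq hqn
  by_contra hc
  obtain ⟨j, hj1, hja, hj⟩ := (s18_mem ha _).1 hT
  have hjq : j ≤ q := by omega
  simp only at hj
  have main : ∀ l ≤ k, (univ.filter (fun i : Fin n => i.val < l ∧ j ≤ a i)).card ≤
      ((occUpTo n n a (fun i => if i ∈ Ttilde n a then n else 0) l).filter (fun x => j ≤ x)).card := by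
    intro l
    induction l with
    | zero => intro _; simp
    | succ l ihl =>
      intro hl
      have i1 := ihl (by omega)
      have hln : l < n := by omega
      have hq' : q ∉ occUpTo n n a (fun i => if i ∈ Ttilde n a then n else 0) l :=
        fun h => hc (s18_mono (by omega) h)
      have hq'' : q ∉ occUpTo n n a (fun i => if i ∈ Ttilde n a then n else 0) (l + 1) :=
        fun h => hc (s18_mono hl h)
      obtain ⟨s, ho⟩ := Option.isSome_iff_exists.1 (s18_b ha ⟨l, hln⟩)
      rw [s18_cnt (fun i => j ≤ a i) hln, s18_succ hln ho]
      have hp := ha ⟨l, hln⟩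
      rw [mem_Icc] at hp
      obtain ⟨h1, h2, h3, h4, h5, h6, -⟩ := s18_spec hp.1 hp.2 ho
      rw [filter_insert]
      by_cases hjl : j ≤ a ⟨l, hln⟩
      · have hs : j ≤ s := by
          by_cases hqa : q ≤ a ⟨l, hln⟩
          · by_contra hlt
            exact hq' (h4 q (by omega) hqa)
          · have hnT : (⟨l, hln⟩ : Fin n) ∉ Ttilde n a := fun hT' =>
              hq' (ih l (by omega) hln hT' q (by omega) hqn)
            have := h6 (by simp [hnT])
            omega
        rw [if_pos hjl, if_pos hs, card_insert_of_notMem (by simp [h1])]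
        omega
      · rw [if_neg hjl]
        split_ifs
        · exact i1.trans (card_le_card (subset_insert _ _))
        · exact i1
  have m := main k le_rfl
  have hs : (occUpTo n n a (fun i => if i ∈ Ttilde n a then n else 0) k).filter (fun x => j ≤ x) ⊆
      (Icc j n).erase q := by
    intro x hx
    rw [mem_filter] at hx
    have := (s18_sub ha hk.le).1 hx.1
    rw [mem_Icc] at this
    rw [mem_erase, mem_Icc]
    refine ⟨?_, hx.2, this.2⟩
    rintro rfl
    exact hc hx.1
  have h2 := card_le_card hs
  rw [card_erase_of_mem (by rw [mem_Icc]; omega), Nat.card_Icc] at h2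
  omega

lemma s18_diff {O O' : Finset ℕ} {s s' : ℕ}
    (h : s ∈ O' ∨ s = s' ∨ (s' ∈ O ∧ s' ∉ O')) :
    (insert s O \ insert s' O').card ≤ (O \ O').card := by
  rcases h with h | h | ⟨h, h'⟩
  · apply card_le_card
    intro x
    simp only [mem_sdiff, mem_insert]
    rintro ⟨rfl | h1, h2⟩ <;> tauto
  · apply card_le_card
    intro x
    subst h
    simp only [mem_sdiff, mem_insert]
    tauto
  · have hm : s' ∈ O \ O' := mem_sdiff.2 ⟨h, h'⟩
    have hs : insert s O \ insert s' O' ⊆ insert s ((O \ O').erase s') := by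
      intro x
      simp only [mem_sdiff, mem_insert, mem_erase]
      tauto
    have h1 := card_le_card hs
    have h2 := card_insert_le s ((O \ O').erase s')
    have h3 := card_erase_add_one hm
    omega

lemma s18_sub2 {O O' : Finset ℕ} {s s' : ℕ} (hs : s ∈ O') :
    insert s O \ insert s' O' ⊆ (O \ O').erase s' := by
  intro x
  simp only [mem_sdiff, mem_insert, mem_erase]
  rintro ⟨rfl | hx, hx2⟩ <;> tauto

lemma s18_sub3 (O O' : Finset ℕ) (s s' : ℕ) :
    insert s O \ insert s' O' ⊆ insert s (O \ O') := by
  intro x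
  simp only [mem_sdiff, mem_insert]
  tauto

set_option maxHeartbeats 1000000 in
lemma s18_a {n : ℕ} (hn : 1 ≤ n) {a r : Fin n → ℕ} (ha : ∀ i, a i ∈ Finset.Icc 1 n)
    (hr : ∀ i, r i = 0 ∨ r i = n) (hA : AllPark n n a r) : ∀ k ≤ n,
    (univ.filter (fun i : Fin n => i.val < k ∧ i ∈ Ttilde n a)).card +
      (occUpTo n n a r k \ occUpTo n n a (fun i => if i ∈ Ttilde n a then n else 0) k).card ≤
    (univ.filter (fun i : Fin n => i.val < k ∧ r i = n)).card := by
  intro k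
  induction k with
  | zero => intro _; simp [occUpTo]
  | succ k ih =>
    intro hk
    have hkn : k < n := hk
    have i1 := ih hkn.le
    have hB := s18_b ha
    have hfull := s18_mem_full ha k hkn
    obtain ⟨s, ho⟩ := Option.isSome_iff_exists.1 (hA ⟨k, hkn⟩)
    obtain ⟨s', ho'⟩ := Option.isSome_iff_exists.1 (hB ⟨k, hkn⟩)
    have hp := ha ⟨k, hkn⟩
    rw [mem_Icc] at hp
    have hc1 := fun q => (s18_cross (r := r) (q := q) ha hkn.le)
    have hc2 := fun q => (s18_cross (r := fun i => if i ∈ Ttilde n a then n else 0)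
      (q := q) ha hkn.le)
    have hsub := (s18_sub (r := r) ha hkn.le).1
    rw [s18_cnt _ hkn, s18_cnt _ hkn, s18_succ hkn ho, s18_succ hkn ho']
    obtain ⟨h1, h2, h3, h4, h5, h6, h7⟩ := s18_spec hp.1 hp.2 ho
    obtain ⟨g1, g2, g3, g4, g5, g6, g7⟩ := s18_spec hp.1 hp.2 ho'
    simp only at h1 h4 h5 h7 g1 g4 g5 g7
    generalize occUpTo n n a r k = O at *
    generalize occUpTo n n a (fun i => if i ∈ Ttilde n a then n else 0) k = O' at *
    by_cases hT : (⟨k, hkn⟩ : Fin n) ∈ Ttilde n a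
    · have hf := hfull hT
      have hs' : s' < a ⟨k, hkn⟩ := by
        by_contra hlt
        exact g1 (hf s' (by omega) g3)
      rcases hr ⟨k, hkn⟩ with h0 | hN
      · have hps := h6 h0
        have hsO : s ∈ O' := hf s hps h3
        have hs'O : s' ∈ O := by
          by_contra hc
          have e1 := (hc1 s' hc).2 hA
          have e2 := (hc2 s' g1).2 hB
          have e3 : (Ioc s' n).card ≤ (O'.filter (fun x => s' < x)).card := by
            apply card_le_card
            intro x hx
            rw [mem_Ioc] at hx
            rw [mem_filter]
            refine ⟨?_, hx.1⟩
            rcases le_total x (a ⟨k, hkn⟩) with hxa | hxa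
            · exact g4 x hx.1 hxa
            · exact hf x hxa hx.2
          have e4 : O.filter (fun x => s' < x) ⊆ (Ioc s' n).erase s := by
            intro x hx
            rw [mem_filter] at hx
            have := hsub hx.1
            rw [mem_Icc] at this
            rw [mem_erase, mem_Ioc]
            refine ⟨?_, hx.2, this.2⟩
            rintro rfl
            exact h1 hx.1
          have e5 := card_le_card e4
          have hmem : s ∈ Ioc s' n := by rw [mem_Ioc]; omega
          have e6 := card_erase_add_one hmem
          omega
        have hsub2 := s18_sub2 (O := O) (s' := s') hsO
        have e1 := card_le_card hsub2
        have e2 := card_erase_add_one (mem_sdiff.2 ⟨hs'O, g1⟩ : s' ∈ O \ O')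
        rw [if_pos hT, if_neg (by omega)]
        omega
      · rw [if_pos hT, if_pos hN]
        have : (insert s O \ insert s' O').card ≤ (O \ O').card := by
          apply s18_diff
          rcases Nat.lt_or_ge s (a ⟨k, hkn⟩) with hlt | hge
          · rcases lt_trichotomy s s' with hl | he | hg
            · exact Or.inr (Or.inr ⟨h4 s' hl hs'.le, g1⟩)
            · exact Or.inr (Or.inl he)
            · exact Or.inl (g4 s hg hlt.le)
          · exact Or.inl (hf s hge h3)
        omega
    · have g6' := g6 (by simp [hT])
      rw [if_neg hT]
      rcases hr ⟨k, hkn⟩ with h0 | hN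
      · have hps := h6 h0
        have : (insert s O \ insert s' O').card ≤ (O \ O').card := by
          apply s18_diff
          rcases lt_trichotomy s s' with hl | he | hg
          · exact Or.inl (g5 s hps hl)
          · exact Or.inr (Or.inl he)
          · exact Or.inr (Or.inr ⟨h5 s' g6' hg, g1⟩)
        rw [if_neg (by omega)]
        omega
      · rw [if_pos hN]
        have hs2 := s18_sub3 O O' s s'
        have e1 := card_le_card hs2
        have e2 := card_insert_le s (O \ O')
        omega

/-- (a) every parking strategy `ρ ∈ {0,n}^n` for `α` has at least
`|T̃|` entries equal to `n`, i.e. `|ρ| ≥ n·|T̃|`; (b) the vector with `r_i = n`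
exactly for `i ∈ T̃` is a parking strategy for `α`. -/
theorem statement18 (n : ℕ) (hn : 1 ≤ n) (a : Fin n → ℕ)
    (ha : ∀ i, a i ∈ Finset.Icc 1 n) :
    (∀ r : Fin n → ℕ, (∀ i, r i = 0 ∨ r i = n) → AllPark n n a r →
      (Ttilde n a).card ≤ (Finset.univ.filter (fun i : Fin n => r i = n)).card ∧
      n * (Ttilde n a).card ≤ ∑ i : Fin n, r i) ∧
    AllPark n n a (fun i => if i ∈ Ttilde n a then n else 0) := by
  refine ⟨?_, s18_b ha⟩
  intro r hr hA
  have h := s18_a hn ha hr hA n le_rfl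
  simp only [Fin.is_lt, true_and, Finset.filter_mem_eq_inter, Finset.univ_inter] at h
  have h1 : (Ttilde n a).card ≤ (Finset.univ.filter (fun i : Fin n => r i = n)).card := by omega
  refine ⟨h1, ?_⟩
  have h2 : ∑ i : Fin n, r i = (Finset.univ.filter (fun i : Fin n => r i = n)).card * n := by
    rw [← smul_eq_mul, ← Finset.sum_const, Finset.sum_filter]
    apply Finset.sum_congr rfl
    intro i _
    rcases hr i with h0 | hN
    · rw [h0, if_neg (by omega)]
    · rw [hN, if_pos rfl]
  rw [h2, mul_comm]
  exact Nat.mul_le_mul_right n h1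
end
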